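/- Let d ≥ 1, let (Ω,μ) be a σ-finite measure space, and let t ∈ (1,∞). Let T : L^∞_c(ℝ^d) → L^0(ℝ^d) be a linear operator such that for all f, g ∈ L^∞_c(ℝ^d) there exists a sparse collection 𝒮 of cubes with ∫_{ℝ^d} |Tf(x)|·|g(x)| dx ≤ C_T ∑_{Q∈𝒮} ⟨f⟩_{1,Q} ⟨g⟩_{1,Q} |Q|, for some fixed C_T ≥ 0. Then there is a constant C depending only on d and t such that for every simple, bounded, boundedly supported f : ℝ^d × Ω → ℂ and every g ∈ L^∞_c(ℝ^d), there exists a sparse collection 𝒮 of cubes with ∫_{ℝ^d} ‖T̃f(x,·)‖_{L^t(Ω)} · |g(x)| dx ≤ C · C_T · ∑_{Q∈𝒮} ⟨‖f(·,·)‖_{L^t(Ω)}⟩_{1,Q} ⟨g⟩_{1,Q} |Q|, where T̃f(x,ω) := T(f(·,ω))(x) is the (tensor) extension of T, which is well defined for simple f. -/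

import Mathlib

open MeasureTheory ENNReal

noncomputable section

structure Cube (d : ℕ) where
  corner : Fin d → ℝ
  side : ℝ
  side_pos : 0 < side

namespace Cube
def set {d : ℕ} (Q : Cube d) : Set (Fin d → ℝ) :=
  {x | ∀ i, Q.corner i ≤ x i ∧ x i < Q.corner i + Q.side}
def vol {d : ℕ} (Q : Cube d) : ℝ≥0∞ := volume Q.set
def IsDyadic {d : ℕ} (Q : Cube d) : Prop :=
  ∃ (k : ℤ) (n : Fin d → ℤ), Q.side = (2:ℝ) ^ (-k) ∧ ∀ i, Q.corner i = (2:ℝ) ^ (-k) * (n i : ℝ)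
end Cube

def IsSparse {d : ℕ} (S : Set (Cube d)) : Prop :=
  ∃ E : Cube d → Set (Fin d → ℝ),
    (∀ Q ∈ S, MeasurableSet (E Q) ∧ E Q ⊆ Q.set ∧ Q.vol ≤ 2 * volume (E Q)) ∧
    S.PairwiseDisjoint E

def eNorm {α : Type*} [MeasurableSpace α] (p : ℝ≥0∞) (μ : Measure α) (F : α → ℝ≥0∞) : ℝ≥0∞ :=
  if p = ∞ then essSup F μ else (∫⁻ x, F x ^ p.toReal ∂μ) ^ (1 / p.toReal)

def nn {α : Type*} (f : α → ℂ) : α → ℝ≥0∞ := fun x => (‖f x‖₊ : ℝ≥0∞)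

def avg {d : ℕ} (r : ℝ≥0∞) (F : (Fin d → ℝ) → ℝ≥0∞) (Q : Cube d) : ℝ≥0∞ :=
  if r = ∞ then essSup F (volume.restrict Q.set)
  else ((∫⁻ x in Q.set, F x ^ r.toReal) / Q.vol) ^ (1 / r.toReal)

def maximal {d k : ℕ} (r : Fin k → ℝ≥0∞) (F : Fin k → (Fin d → ℝ) → ℝ≥0∞)
    (x : Fin d → ℝ) : ℝ≥0∞ :=
  ⨆ (Q : Cube d) (_ : x ∈ Q.set), ∏ j, avg (r j) (F j) Q

def maximalX {d k : ℕ} (r : Fin k → ℝ≥0∞) (ρ : ℝ≥0∞) (F : Fin k → (Fin d → ℝ) → ℝ≥0∞)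
    (G : (Fin d → ℝ) → ℝ≥0∞) (x : Fin d → ℝ) : ℝ≥0∞ :=
  ⨆ (Q : Cube d) (_ : x ∈ Q.set), (∏ j, avg (r j) (F j) Q) * avg ρ G Q

def wNorm {d : ℕ} (p : ℝ≥0∞) (w : (Fin d → ℝ) → ℝ) (F : (Fin d → ℝ) → ℝ≥0∞) : ℝ≥0∞ :=
  eNorm p volume (fun x => F x * ENNReal.ofReal (w x))

def aConst {d m : ℕ} (p r : Fin m → ℝ≥0∞) (s : ℝ≥0∞)
    (w : Fin m → (Fin d → ℝ) → ℝ) : ℝ≥0∞ :=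
  ⨆ Q : Cube d,
    (∏ j, avg ((r j)⁻¹ - (p j)⁻¹)⁻¹ (fun x => ENNReal.ofReal (w j x)⁻¹) Q) *
      avg ((∑ j, (p j)⁻¹) - s⁻¹)⁻¹ (fun x => ENNReal.ofReal (∏ j, w j x)) Q

def latAvg {d : ℕ} {Ω : Type*} (r : ℝ≥0∞) (f : (Fin d → ℝ) → Ω → ℂ) (Q : Cube d) (ω : Ω) : ℝ≥0∞ :=
  ((∫⁻ y in Q.set, (‖f y ω‖₊ : ℝ≥0∞) ^ r.toReal) / Q.vol) ^ (1 / r.toReal)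

def latMax {d m : ℕ} {Ω : Type*} (r : Fin m → ℝ≥0∞) (D : Finset (Cube d))
    (f : Fin m → (Fin d → ℝ) → Ω → ℂ) (x : Fin d → ℝ) (ω : Ω) : ℝ≥0∞ :=
  ⨆ Q ∈ D, ⨆ (_ : x ∈ Cube.set Q), ∏ j, latAvg (r j) (f j) Q ω

def latMaxX {d m : ℕ} {Ω : Type*} (r : Fin m → ℝ≥0∞) (ρ : ℝ≥0∞) (D : Finset (Cube d))
    (f : Fin m → (Fin d → ℝ) → Ω → ℂ) (g : (Fin d → ℝ) → Ω → ℂ)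
    (x : Fin d → ℝ) (ω : Ω) : ℝ≥0∞ :=
  ⨆ Q ∈ D, ⨆ (_ : x ∈ Cube.set Q), (∏ j, latAvg (r j) (f j) Q ω) * latAvg ρ g Q ω

def MemLinftyC {d : ℕ} (f : (Fin d → ℝ) → ℂ) : Prop :=
  Measurable f ∧ (∃ M : ℝ, ∀ x, ‖f x‖ ≤ M) ∧ Bornology.IsBounded (Function.support f)

def SimpleLinftyC {d : ℕ} (f : (Fin d → ℝ) → ℂ) : Prop :=
  Measurable f ∧ (Set.range f).Finite ∧ Bornology.IsBounded (Function.support f)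

def PairSimple {d : ℕ} {Ω : Type*} [MeasurableSpace Ω] (f : (Fin d → ℝ) → Ω → ℂ) : Prop :=
  Measurable (Function.uncurry f) ∧ (Set.range (Function.uncurry f)).Finite ∧
    ∃ B : Set (Fin d → ℝ), Bornology.IsBounded B ∧ ∀ x ∉ B, ∀ ω, f x ω = 0

def VecSimple {d : ℕ} {Ω : Type*} [MeasurableSpace Ω] (f : (Fin d → ℝ) → Ω → ℂ) : Prop :=
  ∃ (N : ℕ) (A : Fin N → Set (Fin d → ℝ)) (ξ : Fin N → Ω → ℂ),
    (∀ i, MeasurableSet (A i)) ∧ (∀ i, Bornology.IsBounded (A i)) ∧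
    (∀ i, Measurable (ξ i)) ∧ (∃ M : ℝ, ∀ i ω, ‖ξ i ω‖ ≤ M) ∧
    ∀ x ω, f x ω = ∑ i, (A i).indicator (fun _ => ξ i ω) x

lemma aux_cancel {J N : ℝ≥0∞} {t q : ℝ} (hpq : t.HolderConjugate q) (hJ : J ≠ ∞)
    (h : J ≤ N * J ^ (1 / q)) : J ≤ N ^ t := by
  rcases eq_or_ne J 0 with h0 | h0
  · simp [h0]
  have h1 : J ^ (1/t) * J ^ (1/q) = J := by
    rw [← ENNReal.rpow_add _ _ h0 hJ, one_div, one_div, hpq.inv_add_inv_eq_one, ENNReal.rpow_one]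
  have h2 : J ^ (1/q) ≠ 0 := by
    simp [ENNReal.rpow_eq_zero_iff, h0, hJ]
  have h3 : J ^ (1/q) ≠ ∞ := ENNReal.rpow_ne_top_of_nonneg (by have := hpq.symm.pos; positivity) hJ
  have h4 : J ^ (1/t) ≤ N := by
    rw [← ENNReal.mul_le_mul_iff_left h2 h3, h1]; exact h
  calc J = (J ^ (1/t)) ^ t := by
        rw [← ENNReal.rpow_mul, one_div, inv_mul_cancel₀ hpq.pos.ne', ENNReal.rpow_one]
    _ ≤ N ^ t := ENNReal.rpow_le_rpow h4 hpq.pos.le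

lemma minkowski_int {X Ω : Type*} [MeasurableSpace X] [MeasurableSpace Ω] (ν : Measure X)
    [SFinite ν] (μ : Measure Ω) [SigmaFinite μ] (F : X → Ω → ℝ≥0∞)
    (hF : Measurable (Function.uncurry F)) {t q : ℝ} (hpq : t.HolderConjugate q) :
    ∫⁻ ω, (∫⁻ x, F x ω ∂ν) ^ t ∂μ ≤ (∫⁻ x, (∫⁻ ω, F x ω ^ t ∂μ) ^ (1 / t) ∂ν) ^ t := by
  have ht0 : 0 < t := hpq.pos
  have ht1 : 0 < t - 1 := by linarith [hpq.lt]
  set I : Ω → ℝ≥0∞ := fun ω => ∫⁻ x, F x ω ∂ν with hI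
  have hIm : Measurable I := Measurable.lintegral_prod_left' hF
  set N := ∫⁻ x, (∫⁻ ω, F x ω ^ t ∂μ) ^ (1 / t) ∂ν with hN
  set J : ℕ → Ω → ℝ≥0∞ := fun n => (spanningSets μ n).indicator (fun ω => min (I ω) n) with hJ
  have hJm : ∀ n, Measurable (J n) := fun n =>
    (hIm.min measurable_const).indicator (measurableSet_spanningSets μ n)
  have hJI : ∀ n ω, J n ω ≤ I ω := by
    intro n ω
    simp only [hJ, Set.indicator]
    split_ifs
    · exact min_le_left _ _
    · simp
  have hJmono : Monotone J := by
    intro a b hab ω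
    simp only [hJ, Set.indicator]
    split_ifs with h1 h2
    · exact min_le_min le_rfl (by exact_mod_cast hab)
    · exact absurd (monotone_spanningSets μ hab h1) h2
    · simp
    · simp
  have hJsup : ∀ ω, ⨆ n, J n ω = I ω := by
    intro ω
    apply le_antisymm (iSup_le fun n => hJI n ω)
    obtain ⟨m, hm⟩ : ∃ m, ω ∈ spanningSets μ m := by
      have : ω ∈ ⋃ i, spanningSets μ i := by rw [iUnion_spanningSets]; trivial
      exact Set.mem_iUnion.1 this
    apply le_of_forall_lt
    intro c hc
    obtain ⟨k, hk⟩ := ENNReal.exists_nat_gt (ne_top_of_lt hc)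
    rw [lt_iSup_iff]
    refine ⟨max m k, ?_⟩
    have : ω ∈ spanningSets μ (max m k) := monotone_spanningSets μ (le_max_left _ _) hm
    simp only [hJ, Set.indicator_of_mem this]
    refine lt_min hc (hk.trans_le ?_)
    exact_mod_cast le_max_right _ _
  have key : ∀ n, ∫⁻ ω, J n ω ^ t ∂μ ≤ N ^ t := by
    intro n
    apply aux_cancel hpq
    · have : ∫⁻ ω, J n ω ^ t ∂μ ≤ ∫⁻ ω, (spanningSets μ n).indicator (fun _ => (n:ℝ≥0∞)^t) ω ∂μ := by
        apply lintegral_mono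
        intro ω
        simp only [hJ, Set.indicator]
        split_ifs
        · exact ENNReal.rpow_le_rpow (min_le_right _ _) ht0.le
        · simp [ht0]
      refine ne_top_of_le_ne_top ?_ this
      rw [lintegral_indicator_const (measurableSet_spanningSets μ n)]
      exact ENNReal.mul_ne_top (ENNReal.rpow_ne_top_of_nonneg ht0.le (by simp))
        (measure_spanningSets_lt_top μ n).ne
    · calc ∫⁻ ω, J n ω ^ t ∂μ ≤ ∫⁻ ω, I ω * J n ω ^ (t-1) ∂μ := by
            apply lintegral_mono
            intro ω
            have : J n ω ^ t = J n ω * J n ω ^ (t-1) := by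
              conv_lhs => rw [show t = 1 + (t-1) by ring]
              rw [ENNReal.rpow_add_of_nonneg _ _ zero_le_one ht1.le, ENNReal.rpow_one]
            show J n ω ^ t ≤ _
            rw [this]
            exact mul_le_mul_left (hJI n ω) _
        _ = ∫⁻ ω, ∫⁻ x, F x ω * J n ω ^ (t-1) ∂ν ∂μ := by
            apply lintegral_congr
            intro ω
            rw [lintegral_mul_const _ (show Measurable fun x => F x ω from hF.comp (measurable_id.prodMk measurable_const))]
        _ = ∫⁻ x, ∫⁻ ω, F x ω * J n ω ^ (t-1) ∂μ ∂ν := by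
            rw [lintegral_lintegral_swap]
            apply Measurable.aemeasurable
            exact (hF.comp measurable_swap).mul (((hJm n).comp measurable_fst).pow_const _)
        _ ≤ ∫⁻ x, (∫⁻ ω, F x ω ^ t ∂μ) ^ (1 / t) * (∫⁻ ω, J n ω ^ t ∂μ) ^ (1 / q) ∂ν := by
            apply lintegral_mono
            intro x
            have := ENNReal.lintegral_mul_le_Lp_mul_Lq μ hpq (f := F x)
              (g := fun ω => J n ω ^ (t-1)) (hF.comp (measurable_const.prodMk measurable_id)).aemeasurable
              ((hJm n).pow_const _).aemeasurable
            refine this.trans_eq ?_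
            congr 3
            ext ω
            rw [← ENNReal.rpow_mul, hpq.sub_one_mul_conj]
        _ = N * (∫⁻ ω, J n ω ^ t ∂μ) ^ (1 / q) := by
            rw [lintegral_mul_const]
            exact (Measurable.lintegral_prod_right' (f := fun p : X × Ω => F p.1 p.2 ^ t)
              (hF.pow_const _)).pow_const _
  calc ∫⁻ ω, I ω ^ t ∂μ = ∫⁻ ω, ⨆ n, J n ω ^ t ∂μ := by
        apply lintegral_congr
        intro ω
        rw [← hJsup ω]
        exact ((ENNReal.orderIsoRpow t ht0).map_iSup _)
    _ = ⨆ n, ∫⁻ ω, J n ω ^ t ∂μ := by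
        apply lintegral_iSup (fun n => (hJm n).pow_const _)
        intro a b hab ω
        exact ENNReal.rpow_le_rpow (hJmono hab ω) ht0.le
    _ ≤ N ^ t := iSup_le key

/-- running maximum -/
def runMax {X : Type*} (s : ℕ → X → ℝ≥0∞) : ℕ → X → ℝ≥0∞
  | 0 => s 0
  | (n+1) => fun x => max (runMax s n x) (s (n+1) x)

lemma runMax_measurable {X : Type*} [MeasurableSpace X] {s : ℕ → X → ℝ≥0∞}
    (hs : ∀ n, Measurable (s n)) (n : ℕ) : Measurable (runMax s n) := by
  induction n with
  | zero => exact hs 0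
  | succ n ih => exact ih.max (hs _)

lemma le_runMax {X : Type*} (s : ℕ → X → ℝ≥0∞) {m n : ℕ} (h : m ≤ n) (x : X) :
    s m x ≤ runMax s n x := by
  induction n with
  | zero => obtain rfl : m = 0 := by omega
            exact le_rfl
  | succ n ih =>
    rcases Nat.lt_or_ge n m with h' | h'
    · obtain rfl : m = n + 1 := by omega
      exact le_max_right _ _
    · exact (ih h').trans (le_max_left _ _)

lemma runMax_le {X : Type*} {s : ℕ → X → ℝ≥0∞} {B : ℝ≥0∞} {x : X} (h : ∀ m, s m x ≤ B) (n : ℕ) :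
    runMax s n x ≤ B := by
  induction n with
  | zero => exact h 0
  | succ n ih => exact max_le ih (h _)

lemma doob_pt {t q : ℝ} (hpq : t.HolderConjugate q) (M s : ℝ≥0∞) (hM : M ≠ ∞) (hs : s ≠ ∞) :
    max M s ^ t + ENNReal.ofReal q * (s * M ^ (t-1)) ≤
      M ^ t + ENNReal.ofReal q * (s * max M s ^ (t-1)) := by
  rcases le_total s M with h | h
  · rw [max_eq_left h]
  rw [max_eq_right h]
  lift M to NNReal using hM
  lift s to NNReal using hs
  have ht0 : 0 < t := hpq.pos
  have ht1 : 0 < t - 1 := by linarith [hpq.lt]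
  have hq0 : 0 < q := hpq.symm.pos
  have key : (s:ℝ) ^ t + q * (s * (M:ℝ) ^ (t-1)) ≤ (M:ℝ)^t + q * (s * (s:ℝ)^(t-1)) := by
    have hy := Real.young_inequality_of_nonneg (a := s) (b := (M:ℝ)^(t-1)) s.2
      (Real.rpow_nonneg M.2 _) hpq
    rw [← Real.rpow_mul M.coe_nonneg, hpq.sub_one_mul_conj] at hy
    have e1 : (s:ℝ) * (s:ℝ)^(t-1) = (s:ℝ)^t := by
      conv_lhs => rw [← Real.rpow_one (s:ℝ)]
      rw [Real.rpow_one, mul_comm, ← Real.rpow_add_one' s.coe_nonneg (by linarith)]; congr 1; ring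
    rw [e1]
    have e2 : q / t = q - 1 := hpq.symm.div_conj_eq_sub_one
    have : q * (s * (M:ℝ) ^ (t-1)) ≤ q * ((s:ℝ) ^ t / t + (M:ℝ)^t / q) := by gcongr
    have e3 : q * ((s:ℝ) ^ t / t + (M:ℝ)^t / q) = (q/t) * (s:ℝ)^t + (M:ℝ)^t := by field_simp
    rw [e3, e2] at this
    linarith
  lift q to NNReal using hq0.le
  rw [ENNReal.ofReal_coe_nnreal, ← ENNReal.coe_rpow_of_nonneg _ ht0.le, ← ENNReal.coe_rpow_of_nonneg _ ht0.le,
    ← ENNReal.coe_rpow_of_nonneg _ ht1.le, ← ENNReal.coe_rpow_of_nonneg _ ht1.le]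
  exact_mod_cast key

lemma doob_young {t q : ℝ} (hpq : t.HolderConjugate q) :
    ∃ C : ℝ≥0∞, C ≠ ∞ ∧ ∀ M s : ℝ≥0∞,
     2 * (ENNReal.ofReal q * (s * M ^ (t-1))) ≤ M ^ t + C * s ^ t := by
  have ht0 : 0 < t := hpq.pos
  have hq0 : 0 < q := hpq.symm.pos
  have ht1 : 0 < t - 1 := by linarith [hpq.lt]
  refine ⟨(2 * ENNReal.ofReal q)^t, ENNReal.rpow_ne_top_of_nonneg ht0.le (by finiteness), fun M s => ?_⟩
  have := ENNReal.young_inequality (2 * ENNReal.ofReal q * s) (M ^ (t-1)) hpq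
  calc _ = 2 * ENNReal.ofReal q * s * M ^ (t-1) := by ring
    _ ≤ _ := this
    _ ≤ (2 * ENNReal.ofReal q * s)^t + (M ^ (t-1))^q := by
      gcongr
      · refine (ENNReal.div_le_of_le_mul ?_)
        exact le_mul_of_one_le_right zero_le (by simpa using hpq.lt.le)
      · refine (ENNReal.div_le_of_le_mul ?_)
        exact le_mul_of_one_le_right zero_le (by simpa using hpq.symm.lt.le)
    _ = _ := by
      rw [ENNReal.mul_rpow_of_nonneg _ _ ht0.le, ← ENNReal.rpow_mul, hpq.sub_one_mul_conj, add_comm]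

/-- Doob maximal inequality, abstract form. -/
lemma doob {t q : ℝ} (hpq : t.HolderConjugate q) :
    ∃ C : ℝ≥0∞, C ≠ ∞ ∧ ∀ {X : Type} [MeasurableSpace X] (ν : Measure X) [IsFiniteMeasure ν]
      (s : ℕ → X → ℝ≥0∞) (B : ℝ≥0∞), B ≠ ∞ → (∀ n x, s n x ≤ B) → (∀ n, Measurable (s n)) →
      (∀ n, ∫⁻ x, s (n+1) x * runMax s n x ^ (t-1) ∂ν = ∫⁻ x, s n x * runMax s n x ^ (t-1) ∂ν) →
      ∀ n, ∫⁻ x, runMax s n x ^ t ∂ν ≤ C * ∫⁻ x, s n x ^ t ∂ν := by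
  obtain ⟨C, hC, hy⟩ := doob_young hpq
  refine ⟨C, hC, ?_⟩
  intro X _ ν _ s B hB hsB hsm hmart n
  have ht0 : 0 < t := hpq.pos
  have ht1 : 0 < t - 1 := by linarith [hpq.lt]
  have hq0 : 0 < q := hpq.symm.pos
  have hM : ∀ n, Measurable (runMax s n) := runMax_measurable hsm
  have hsM : ∀ n m, Measurable (fun x => s n x * runMax s m x ^ (t-1)) := fun n m =>
    (hsm n).mul ((hM m).pow_const _)
  have hMB : ∀ n x, runMax s n x ≤ B := fun n x => runMax_le (fun m => hsB m x) n
  have fin1 : ∀ n, ∫⁻ x, runMax s n x ^ t ∂ν ≠ ∞ := by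
    intro n
    refine ne_top_of_le_ne_top (b := ∫⁻ x, B ^ t ∂ν) ?_ (lintegral_mono fun x =>
      ENNReal.rpow_le_rpow (hMB n x) ht0.le)
    rw [lintegral_const]
    exact ENNReal.mul_ne_top (ENNReal.rpow_ne_top_of_nonneg ht0.le hB) (measure_ne_top _ _)
  have fin2 : ∀ n, ENNReal.ofReal q * ∫⁻ x, s n x * runMax s n x ^ (t-1) ∂ν ≠ ∞ := by
    intro n
    refine ENNReal.mul_ne_top (by finiteness) ?_
    refine ne_top_of_le_ne_top (b := ∫⁻ x, B * B ^ (t-1) ∂ν) ?_ (lintegral_mono fun x =>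
      mul_le_mul' (hsB n x) (ENNReal.rpow_le_rpow (hMB n x) ht1.le))
    rw [lintegral_const]
    exact ENNReal.mul_ne_top (ENNReal.mul_ne_top hB (ENNReal.rpow_ne_top_of_nonneg ht1.le hB)) (measure_ne_top _ _)
  have claim : ∀ n, ∫⁻ x, runMax s n x ^ t ∂ν ≤
      ENNReal.ofReal q * ∫⁻ x, s n x * runMax s n x ^ (t-1) ∂ν := by
    intro n
    induction n with
    | zero =>
      rw [← lintegral_const_mul _ (hsM _ _)]
      apply lintegral_mono
      intro x
      simp only [runMax]
      calc s 0 x ^ t = 1 * (s 0 x * s 0 x ^ (t-1)) := by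
            conv_lhs => rw [show t = 1 + (t-1) by ring]
            rw [ENNReal.rpow_add_of_nonneg _ _ zero_le_one ht1.le, ENNReal.rpow_one, one_mul]
        _ ≤ _ := by
            gcongr
            simpa using hpq.symm.lt.le
    | succ n ih =>
      have h1 : ∫⁻ x, runMax s (n+1) x ^ t ∂ν + ENNReal.ofReal q * ∫⁻ x, s (n+1) x * runMax s n x ^ (t-1) ∂ν
          ≤ ∫⁻ x, runMax s n x ^ t ∂ν + ENNReal.ofReal q * ∫⁻ x, s (n+1) x * runMax s (n+1) x ^ (t-1) ∂ν := by
        rw [← lintegral_const_mul _ (hsM _ _),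
          ← lintegral_const_mul _ (hsM _ _),
          ← lintegral_add_left ((hM _).pow_const _), ← lintegral_add_left ((hM _).pow_const _)]
        apply lintegral_mono
        intro x
        exact doob_pt hpq _ _ (ne_top_of_le_ne_top hB (hMB _ _)) (ne_top_of_le_ne_top hB (hsB _ _))
      rw [hmart n] at h1
      have h2 := h1.trans (add_le_add_left ih _)
      rw [add_comm] at h2
      exact (ENNReal.add_le_add_iff_left (fin2 n)).1 h2
  have h3 : 2 * ∫⁻ x, runMax s n x ^ t ∂ν ≤ ∫⁻ x, runMax s n x ^ t ∂ν + C * ∫⁻ x, s n x ^ t ∂ν := by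
    refine (mul_le_mul_right (claim n) 2).trans ?_
    rw [← lintegral_const_mul _ (hsM _ _),
      ← lintegral_const_mul _ ((hsM _ _).const_mul _),
      ← lintegral_const_mul _ ((hsm _).pow_const _), ← lintegral_add_left ((hM _).pow_const _)]
    exact lintegral_mono fun x => hy _ _
  rw [two_mul] at h3
  exact (ENNReal.add_le_add_iff_left (fin1 n)).1 h3

/-- An abstract dyadic system: nested countable partitions indexed by `ℤ`. -/
structure Grid (X : Type) [MeasurableSpace X] (ν : Measure X) (I : Type) where
  idx : ℤ → X → I
  meas : ∀ k i, MeasurableSet (idx k ⁻¹' {i})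
  refine' : ∀ k x y, idx (k+1) x = idx (k+1) y → idx k x = idx k y
  v : ℤ → ℝ≥0∞
  c : ℝ≥0∞
  c_top : c ≠ ∞
  v_ne_zero : ∀ k, v k ≠ 0
  v_ne_top : ∀ k, v k ≠ ∞
  vol : ∀ k x, ν (idx k ⁻¹' {idx k x}) = v k
  v_step : ∀ k, v k ≤ c * v (k+1)

namespace Grid
variable {X : Type} [MeasurableSpace X] {ν : Measure X} {I : Type} (D : Grid X ν I)

/-- the atom of level `k` containing `x` -/
def A (k : ℤ) (x : X) : Set X := D.idx k ⁻¹' {D.idx k x}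

lemma mem_A (k : ℤ) (x : X) : x ∈ D.A k x := rfl

lemma measA (k : ℤ) (x : X) : MeasurableSet (D.A k x) := D.meas _ _

lemma A_eq {k : ℤ} {x y : X} (h : y ∈ D.A k x) : D.A k y = D.A k x := by
  have : D.idx k y = D.idx k x := h
  simp [A, this]

lemma volA (k : ℤ) (x : X) : ν (D.A k x) = D.v k := D.vol k x

lemma idx_le {k : ℤ} (n : ℕ) {x y : X} (h : D.idx (k+n) x = D.idx (k+n) y) :
    D.idx k x = D.idx k y := by
  induction n with
  | zero => simpa using h
  | succ n ih =>
    apply ih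
    apply D.refine'
    rw [add_assoc]
    exact_mod_cast h

lemma idx_le' {k l : ℤ} (hkl : k ≤ l) {x y : X} (h : D.idx l x = D.idx l y) :
    D.idx k x = D.idx k y := by
  obtain ⟨n, rfl⟩ := Int.le.dest hkl
  exact D.idx_le n h

lemma A_anti {k l : ℤ} (hkl : k ≤ l) (x : X) : D.A l x ⊆ D.A k x :=
  fun _ h => D.idx_le' hkl h

/-- conditional expectation -/
def E (k : ℤ) (f : X → ℝ≥0∞) (x : X) : ℝ≥0∞ := (∫⁻ y in D.A k x, f y ∂ν) / D.v k

/-- constant on atoms of level `k` -/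
def Lev {β : Type*} (k : ℤ) (g : X → β) : Prop := ∀ x y, D.idx k x = D.idx k y → g x = g y

lemma lev_E (k : ℤ) (f : X → ℝ≥0∞) : D.Lev k (D.E k f) := by
  intro x y h
  simp [E, A, h]

variable {D} in
lemma Lev.mono {β : Type*} {k l : ℤ} (hkl : k ≤ l) {g : X → β} (h : D.Lev k g) : D.Lev l g :=
  fun x y hxy => h x y (D.idx_le' hkl hxy)

variable {D} in
lemma Lev.measurable {β : Type*} [MeasurableSpace β] [Countable I] {k : ℤ} {g : X → β}
    (h : D.Lev k g) : Measurable g := by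
  intro s _
  have : g ⁻¹' s = ⋃ i : (D.idx k '' (g ⁻¹' s)), D.idx k ⁻¹' {(i : I)} := by
    ext x
    simp only [Set.mem_preimage, Set.mem_iUnion, Set.mem_singleton_iff]
    constructor
    · intro hx
      exact ⟨⟨_, x, hx, rfl⟩, rfl⟩
    · rintro ⟨⟨_, y, hy, rfl⟩, hx⟩
      rw [h x y hx]
      exact hy
  rw [this]
  exact MeasurableSet.iUnion fun i => D.meas _ _

lemma meas_E [Countable I] (k : ℤ) (f : X → ℝ≥0∞) : Measurable (D.E k f) := (D.lev_E k f).measurable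

lemma E_mul (k : ℤ) (f : X → ℝ≥0∞) (x : X) : D.E k f x * D.v k = ∫⁻ y in D.A k x, f y ∂ν :=
  ENNReal.div_mul_cancel (D.v_ne_zero k) (D.v_ne_top k)

lemma lint_sum [Countable I] (k : ℤ) (f : X → ℝ≥0∞) :
    ∫⁻ x, f x ∂ν = ∑' i : I, ∫⁻ x in D.idx k ⁻¹' {i}, f x ∂ν := by
  rw [← lintegral_iUnion (D.meas k)]
  · rw [← Set.preimage_iUnion, Set.iUnion_of_singleton, Set.preimage_univ, Measure.restrict_univ]
  · intro i j hij
    exact Disjoint.preimage _ (by simpa using hij)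

lemma lint_le [Countable I] (k : ℤ) {f g : X → ℝ≥0∞}
    (h : ∀ x, ∫⁻ y in D.A k x, f y ∂ν ≤ ∫⁻ y in D.A k x, g y ∂ν) : ∫⁻ x, f x ∂ν ≤ ∫⁻ x, g x ∂ν := by
  rw [D.lint_sum k f, D.lint_sum k g]
  refine ENNReal.tsum_le_tsum fun i => ?_
  rcases (D.idx k ⁻¹' {i}).eq_empty_or_nonempty with h0 | ⟨x, hx⟩
  · simp [h0]
  · have : D.idx k x = i := hx
    rw [← this]
    exact h x

lemma lint_eq [Countable I] (k : ℤ) {f g : X → ℝ≥0∞}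
    (h : ∀ x, ∫⁻ y in D.A k x, f y ∂ν = ∫⁻ y in D.A k x, g y ∂ν) : ∫⁻ x, f x ∂ν = ∫⁻ x, g x ∂ν :=
  le_antisymm (D.lint_le k fun x => (h x).le) (D.lint_le k fun x => (h x).ge)

lemma lint_E_mul [Countable I] (k : ℤ) {f u : X → ℝ≥0∞} (hf : Measurable f) (hu : D.Lev k u) :
    ∫⁻ x, D.E k f x * u x ∂ν = ∫⁻ x, f x * u x ∂ν := by
  apply D.lint_eq k
  intro x
  have h1 : ∫⁻ y in D.A k x, D.E k f y * u y ∂ν = ∫⁻ y in D.A k x, D.E k f x * u x ∂ν := by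
    apply setLIntegral_congr_fun (D.measA k x)
    intro y hy
    show D.E k f y * u y = _
    rw [D.lev_E k f y x hy, hu y x hy]
  have h2 : ∫⁻ y in D.A k x, f y * u y ∂ν = ∫⁻ y in D.A k x, f y * u x ∂ν := by
    apply setLIntegral_congr_fun (D.measA k x)
    intro y hy
    show f y * u y = _
    rw [hu y x hy]
  rw [h1, h2, lintegral_mul_const _ hf, setLIntegral_const, volA, ← E_mul]
  ring

/-- indicator function of a set of level k -/
lemma lev_ind {k : ℤ} {p : X → Prop} (hp : D.Lev k p) (u : X → ℝ≥0∞) (hu : D.Lev k u) :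
    D.Lev k (Set.indicator {x | p x} u) := by
  intro x y h
  have := hp x y h
  by_cases hx : p x
  · have hy : p y := this ▸ hx
    rw [Set.indicator_of_mem (show x ∈ {x | p x} from hx), Set.indicator_of_mem (show y ∈ {x | p x} from hy), hu x y h]
  · have hy : ¬ p y := this ▸ hx
    rw [Set.indicator_of_notMem (show x ∉ {x | p x} from hx), Set.indicator_of_notMem (show y ∉ {x | p x} from hy)]

lemma setLInt_E [Countable I] (k : ℤ) {f : X → ℝ≥0∞} (hf : Measurable f) {p : X → Prop} (hp : D.Lev k p) :
    ∫⁻ x in {x | p x}, D.E k f x ∂ν = ∫⁻ x in {x | p x}, f x ∂ν := by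
  have hm : MeasurableSet {x | p x} := by
    have := hp.measurable (measurableSet_singleton True)
    convert this using 1
    ext x; simp
  rw [← lintegral_indicator hm, ← lintegral_indicator hm]
  have := D.lint_E_mul k hf (D.lev_ind hp (fun _ => 1) (fun _ _ _ => rfl))
  convert this using 2
  · ext x; by_cases h : p x <;> simp [Set.indicator, h]
  · ext x; by_cases h : p x <;> simp [Set.indicator, h]

lemma E_step (k : ℤ) (f : X → ℝ≥0∞) (x : X) : D.E (k+1) f x ≤ D.c * D.E k f x := by
  have h0 := D.v_ne_zero (k+1)
  have h1 := D.v_ne_top (k+1)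
  rw [E, ENNReal.div_le_iff h0 h1]
  calc ∫⁻ y in D.A (k+1) x, f y ∂ν ≤ ∫⁻ y in D.A k x, f y ∂ν :=
        lintegral_mono_set (D.A_anti (by omega) x)
    _ = D.E k f x * D.v k := (D.E_mul k f x).symm
    _ ≤ D.E k f x * (D.c * D.v (k+1)) := mul_le_mul_right (D.v_step k) _
    _ = _ := by ring

/-- weak type bound for the dyadic maximal function -/
lemma weak [Countable I] (k : ℤ) {f : X → ℝ≥0∞} (hf : Measurable f) (x : X) (lam : ℝ≥0∞) :
    lam * ν {y | y ∈ D.A k x ∧ ∃ n : ℕ, lam < D.E (k+n) f y} ≤ ∫⁻ y in D.A k x, f y ∂ν := by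
  set B : ℕ → Set X := fun n => {y | (y ∈ D.A k x ∧ lam < D.E (k+n) f y) ∧
    ∀ m < n, ¬ lam < D.E (k+m) f y} with hB
  have hlev : ∀ n : ℕ, D.Lev (k+n) (fun y => (y ∈ D.A k x ∧ lam < D.E (k+n) f y) ∧
    ∀ m < n, ¬ lam < D.E (k+m) f y) := by
    intro n y z h
    have e1 : D.idx k y = D.idx k z := D.idx_le' (by omega) h
    have e2 : ∀ m ≤ n, D.E (k+m) f y = D.E (k+m) f z := fun m hm =>
      D.lev_E _ f y z (D.idx_le' (by omega) h)
    have e3 : y ∈ D.A k x ↔ z ∈ D.A k x := by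
      show D.idx k y = _ ↔ D.idx k z = _
      rw [e1]
    simp only [e3, e2 n le_rfl, eq_iff_iff, and_congr_right_iff]
    intro _
    constructor
    · intro H m hm; rw [← e2 m hm.le]; exact H m hm
    · intro H m hm; rw [e2 m hm.le]; exact H m hm
  have hBm : ∀ n, MeasurableSet (B n) := by
    intro n
    have := (hlev n).measurable (measurableSet_singleton True)
    convert this using 1
    ext y; simp [hB]
  have hdis : Pairwise (Function.onFun Disjoint B) := by
    have : ∀ m n, m < n → Disjoint (B m) (B n) := by
      intro m n hmn
      rw [Set.disjoint_left]
      intro y hy hy'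
      exact hy'.2 m hmn hy.1.2
    intro m n hmn
    rcases lt_or_gt_of_ne hmn with h | h
    · exact this m n h
    · exact (this n m h).symm
  have hU : {y | y ∈ D.A k x ∧ ∃ n : ℕ, lam < D.E (k+n) f y} = ⋃ n, B n := by
    ext y
    simp only [Set.mem_ofPred_eq, Set.mem_iUnion, hB]
    constructor
    · rintro ⟨h1, h2⟩
      classical
      exact ⟨Nat.find h2, ⟨h1, Nat.find_spec h2⟩, fun m hm => Nat.find_min h2 hm⟩
    · rintro ⟨n, ⟨h1, h2⟩, -⟩
      exact ⟨h1, n, h2⟩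
  rw [hU, measure_iUnion hdis hBm, ← ENNReal.tsum_mul_left]
  calc ∑' n, lam * ν (B n) ≤ ∑' n, ∫⁻ y in B n, f y ∂ν := by
        refine ENNReal.tsum_le_tsum fun n => ?_
        rw [← D.setLInt_E (k+n) hf (hlev n), ← setLIntegral_const]
        exact setLIntegral_mono (D.meas_E _ _) fun y hy => hy.1.2.le
    _ = ∫⁻ y in ⋃ n, B n, f y ∂ν := (lintegral_iUnion hBm hdis _).symm
    _ ≤ _ := lintegral_mono_set (Set.iUnion_subset fun n y hy => hy.1.1)

end Grid

/-- last stopping level -/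
def ell {X : Type} (a b : ℕ → X → ℝ≥0∞) : ℕ → X → ℕ
  | 0 => fun _ => 0
  | (n+1) => fun x => open Classical in
      if 8 * a (ell a b n x) x < a (n+1) x ∨ 8 * b (ell a b n x) x < b (n+1) x
      then n+1 else ell a b n x

section ell
variable {X : Type} (a b : ℕ → X → ℝ≥0∞)

lemma ell_le (n : ℕ) (x : X) : ell a b n x ≤ n := by
  induction n with
  | zero => exact le_rfl
  | succ n ih =>
    simp only [ell]
    split_ifs
    · exact le_rfl
    · omega

lemma ell_anc {n m i : ℕ} {x : X} (h : ell a b n x = i) (h1 : i ≤ m) (h2 : m ≤ n) :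
    ell a b m x = i := by
  induction n with
  | zero => obtain rfl : m = 0 := by omega
            exact h
  | succ n ih =>
    rcases Nat.lt_or_ge n m with h' | h'
    · obtain rfl : m = n+1 := by omega
      exact h
    · simp only [ell] at h
      split_ifs at h
      · omega
      · exact ih h h'

lemma ell_bound {n i : ℕ} {x : X} (h : ell a b n x = i) : a n x ≤ 8 * a i x ∧ b n x ≤ 8 * b i x := by
  have triv : ∀ z : ℝ≥0∞, z ≤ 8 * z := fun z => le_mul_of_one_le_left zero_le (by norm_num)
  cases n with
  | zero =>
    obtain rfl : 0 = i := h
    exact ⟨triv _, triv _⟩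
  | succ n =>
    simp only [ell] at h
    split_ifs at h with h1
    · subst h
      exact ⟨triv _, triv _⟩
    · subst h
      push Not at h1
      exact h1

lemma ell_halts {N i : ℕ} {x : X} (h0 : ell a b i x = i) (hi : i ≤ N) (h : ell a b N x ≠ i) :
    ∃ n, 8 * a i x < a (i+n) x ∨ 8 * b i x < b (i+n) x := by
  induction N with
  | zero =>
    obtain rfl : i = 0 := by omega
    exact absurd h0 h
  | succ N ih =>
    rcases Nat.lt_or_ge N i with h' | h'
    · obtain rfl : i = N+1 := by omega
      exact absurd h0 h
    by_cases h2 : ell a b N x = i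
    · simp only [ell] at h
      split_ifs at h with h3
      · rw [h2] at h3
        refine ⟨N+1-i, ?_⟩
        rwa [Nat.add_sub_of_le (by omega)]
      · exact absurd h2 h
    · exact ih h' h2
end ell

/-- stopped process -/
def sp {X : Type} (l : ℕ → X → ℕ) (i : ℕ) (e : ℕ → X → ℝ≥0∞) : ℕ → X → ℝ≥0∞
  | 0 => e i
  | (m+1) => fun x => if l (i+m) x = i then e (i+m+1) x else sp l i e m x

lemma sp_eq {X : Type} (l : ℕ → X → ℕ) (i : ℕ) (e : ℕ → X → ℝ≥0∞)
    (hanc : ∀ n m i x, l n x = i → i ≤ m → m ≤ n → l m x = i) (m : ℕ) (x : X)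
    (h : l (i+m) x = i) : sp l i e m x = e (i+m) x := by
  cases m with
  | zero => rfl
  | succ m =>
    simp only [sp]
    rw [if_pos (hanc _ _ _ _ h (by omega) (by omega))]
    rfl

namespace Grid
variable {X : Type} [MeasurableSpace X] {ν : Measure X} {I : Type} (D : Grid X ν I)

lemma joint_meas {Ω : Type} [MeasurableSpace Ω] [Countable I] {β : Type*} [MeasurableSpace β] (k : ℤ)
    (f : X → Ω → β) (h1 : ∀ x, Measurable (f x)) (h2 : ∀ ω, D.Lev k (fun x => f x ω)) :
    Measurable (Function.uncurry f) := by
  intro s hs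
  have hne : ∀ i : Set.range (D.idx k), ∃ x, D.idx k x = i := fun i => i.2
  choose r hr using hne
  have : Function.uncurry f ⁻¹' s = ⋃ i : Set.range (D.idx k),
      (D.idx k ⁻¹' {(i : I)}) ×ˢ (f (r i) ⁻¹' s) := by
    ext ⟨x, ω⟩
    simp only [Set.mem_preimage, Set.mem_iUnion, Set.mem_prod, Set.mem_singleton_iff, Function.uncurry]
    constructor
    · intro hx
      refine ⟨⟨_, x, rfl⟩, rfl, ?_⟩
      have e : f (r ⟨_, x, rfl⟩) ω = f x ω := h2 ω _ x (hr ⟨_, x, rfl⟩)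
      rw [e]
      exact hx
    · rintro ⟨i, hi, hx⟩
      have e : f x ω = f (r i) ω := h2 ω x (r i) (hi.trans (hr i).symm)
      rw [e]
      exact hx
  rw [this]
  exact MeasurableSet.iUnion fun i => (D.meas _ _).prod (h1 _ hs)

lemma lev_sp {k0 : ℤ} (l : ℕ → X → ℕ) (hl : ∀ n : ℕ, D.Lev (k0+n) (l n)) (i : ℕ) (e : ℕ → X → ℝ≥0∞)
    (he : ∀ n : ℕ, D.Lev (k0+n) (e n)) (m : ℕ) : D.Lev (k0 + (i+m : ℕ)) (sp l i e m) := by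
  induction m with
  | zero => exact he i
  | succ m ih =>
    intro x y h
    have h' : D.idx (k0 + (i+m:ℕ)) x = D.idx (k0 + (i+m:ℕ)) y := D.idx_le' (by push_cast; omega) h
    simp only [sp]
    rw [hl _ x y h', he (i+m+1) x y h, ih x y h']

lemma lev_runMax {k0 : ℤ} (s : ℕ → X → ℝ≥0∞) (i : ℕ) (hs : ∀ m : ℕ, D.Lev (k0 + (i+m : ℕ)) (s m)) (m : ℕ) :
    D.Lev (k0 + (i+m : ℕ)) (runMax s m) := by
  induction m with
  | zero => exact hs 0
  | succ m ih =>
    intro x y h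
    simp only [runMax]
    rw [hs _ x y h, ih x y (D.idx_le' (by push_cast; omega) h)]

lemma sp_mart [Countable I] {k0 : ℤ} (l : ℕ → X → ℕ) (hl : ∀ n : ℕ, D.Lev (k0+n) (l n)) 
    (hanc : ∀ n m i x, l n x = i → i ≤ m → m ≤ n → l m x = i) (i : ℕ) {f : X → ℝ≥0∞}
    (hf : Measurable f) (x0 : X) (m : ℕ) (w : X → ℝ≥0∞) (hw : D.Lev (k0 + (i+m:ℕ)) w) :
    ∫⁻ x in D.A (k0+i) x0, sp l i (fun n => D.E (k0+n) f) (m+1) x * w x ∂ν =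
    ∫⁻ x in D.A (k0+i) x0, sp l i (fun n => D.E (k0+n) f) m x * w x ∂ν := by
  set e : ℕ → X → ℝ≥0∞ := fun n => D.E (k0+n) f with he
  have hsp := D.lev_sp l hl i e (fun n => D.lev_E _ _)
  have hpP : D.Lev (k0 + (i+m:ℕ)) (fun x => x ∈ D.A (k0+i) x0) := by
    intro x y h
    have := D.idx_le' (k := k0 + i) (by push_cast; omega) h
    show (D.idx _ x = _) = (D.idx _ y = _)
    rw [this]
  have hpl : D.Lev (k0 + (i+m:ℕ)) (fun x => l (i+m) x = i) := by
    intro x y h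
    show (l (i+m) x = i) = (l (i+m) y = i)
    rw [hl _ x y h]
  have hu1 := D.lev_ind hpl _ (D.lev_ind hpP w hw)
  set u1 := Set.indicator {x | l (i+m) x = i} (Set.indicator {x | x ∈ D.A (k0+i) x0} w) with hu1d
  set u2 := Set.indicator {x | ¬ l (i+m) x = i} (Set.indicator {x | x ∈ D.A (k0+i) x0} w) with hu2d
  have hu1m : Measurable u1 := hu1.measurable
  have hem : ∀ n, Measurable (e n) := fun n => D.meas_E _ _
  rw [← lintegral_indicator (D.measA _ _), ← lintegral_indicator (D.measA _ _)]
  have e1 : (fun x => (D.A (k0+i) x0).indicator (fun x => sp l i e (m+1) x * w x) x) =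
      fun x => e (i+m+1) x * u1 x + sp l i e m x * u2 x := by
    ext x
    by_cases hx : x ∈ D.A (k0+i) x0 <;> by_cases hx2 : l (i+m) x = i <;>
      simp [hu1d, hu2d, hx, hx2, sp, Set.indicator]
  have e2 : (fun x => (D.A (k0+i) x0).indicator (fun x => sp l i e m x * w x) x) =
      fun x => e (i+m) x * u1 x + sp l i e m x * u2 x := by
    ext x
    by_cases hx2 : l (i+m) x = i
    · rw [← sp_eq l i e hanc m x hx2]
      by_cases hx : x ∈ D.A (k0+i) x0 <;>
      simp [hu1d, hu2d, hx, hx2, Set.indicator]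
    · by_cases hx : x ∈ D.A (k0+i) x0 <;>
      simp [hu1d, hu2d, hx, hx2, Set.indicator]
  have hmul : ∀ n, Measurable (fun x => e n x * u1 x) := fun n => (hem n).mul hu1m
  rw [e1, e2, lintegral_add_left (hmul _), lintegral_add_left (hmul _)]
  congr 1
  have h1 := D.lint_E_mul (k0 + (i+m+1:ℕ)) hf (hu1.mono (by push_cast; omega))
  have h2 := D.lint_E_mul (k0 + (i+m:ℕ)) hf hu1
  exact h1.trans h2.symm

lemma E_le_bound (k : ℤ) (f : X → ℝ≥0∞) (B : ℝ≥0∞) (hB : ∀ x, f x ≤ B) (x : X) : D.E k f x ≤ B := by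
  rw [E, ENNReal.div_le_iff (D.v_ne_zero k) (D.v_ne_top k), ← D.volA k x, ← setLIntegral_const]
  exact lintegral_mono fun y => hB y

lemma E_mink {Ω : Type} [MeasurableSpace Ω] (μ : Measure Ω) [SigmaFinite μ] [SFinite ν]
    {t q : ℝ} (hpq : t.HolderConjugate q) (F : X → Ω → ℝ≥0∞)
    (hF : Measurable (Function.uncurry F)) (Fn : X → ℝ≥0∞)
    (hFn : ∀ x, (∫⁻ ω, F x ω ^ t ∂μ) ^ (1/t) ≤ Fn x) (k : ℤ) (x : X) :
    ∫⁻ ω, (D.E k (fun y => F y ω) x) ^ t ∂μ ≤ (D.E k Fn x) ^ t := by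
  have ht := hpq.pos
  have h := minkowski_int (ν.restrict (D.A k x)) μ F hF hpq
  simp only [E, div_eq_mul_inv, ENNReal.mul_rpow_of_nonneg _ _ ht.le]
  rw [lintegral_mul_const]
  · gcongr
    refine h.trans ?_
    gcongr with y
    exact hFn y
  · exact (Measurable.lintegral_prod_left' hF).pow_const _

lemma half [Countable I] {t q : ℝ} (hpq : t.HolderConjugate q) :
    ∃ C : ℝ≥0∞, C ≠ ∞ ∧ ∀ {X : Type} [MeasurableSpace X] {ν : Measure X} [SFinite ν] (D : Grid X ν I)
      {Ω : Type} [MeasurableSpace Ω] (μ : Measure Ω) [SigmaFinite μ]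
      (F : X → Ω → ℝ≥0∞) (_ : Measurable (Function.uncurry F)) (B : ℝ≥0∞) (_ : B ≠ ∞)
      (_ : ∀ x ω, F x ω ≤ B) (Fn : X → ℝ≥0∞)
      (_ : ∀ x, (∫⁻ ω, F x ω ^ t ∂μ) ^ (1/t) ≤ Fn x) (k0 : ℤ)
      (l : ℕ → X → ℕ) (_ : ∀ n : ℕ, D.Lev (k0+n) (l n))
      (_ : ∀ n m i x, l n x = i → i ≤ m → m ≤ n → l m x = i)
      (_ : ∀ (n i : ℕ) x, l n x = i → D.E (k0+n) Fn x ≤ 8 * D.E (k0+i) Fn x)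
      (i m : ℕ) (x0 : X),
      ∫⁻ x in D.A (k0+i) x0, ∫⁻ ω, runMax (sp l i (fun n => D.E (k0+n) (fun y => F y ω))) m x ^ t ∂μ ∂ν
        ≤ C * ((8 * (D.c + 1) * D.E (k0+i) Fn x0) ^ t * D.v (k0+i)) := by
  obtain ⟨C, hC, hd⟩ := doob hpq
  refine ⟨C, hC, ?_⟩
  intro X _ ν _ D Ω _ μ _ F hF B hB hFB Fn hFn k0 l hl hanc hbd i m x0
  have ht := hpq.pos
  have hFω : ∀ ω, Measurable (fun y => F y ω) := fun ω => hF.comp (measurable_id.prodMk measurable_const)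
  -- measurability
  have hlevsp : ∀ ω m, D.Lev (k0 + (i+m:ℕ)) (sp l i (fun n => D.E (k0+n) (fun y => F y ω)) m) :=
    fun ω => D.lev_sp l hl i _ (fun n => D.lev_E _ _)
  have hEω : ∀ n x, Measurable (fun ω => D.E (k0+(n:ℕ)) (fun y => F y ω) x) := by
    intro n x
    exact (Measurable.lintegral_prod_left' hF).div_const _
  have hspω : ∀ m x, Measurable (fun ω => sp l i (fun n => D.E (k0+n) (fun y => F y ω)) m x) := by
    intro m x
    induction m with
    | zero => exact hEω _ _
    | succ m ih =>
      simp only [sp]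
      split_ifs
      · exact hEω _ _
      · exact ih
  have hrmω : ∀ m x, Measurable (fun ω => runMax (sp l i (fun n => D.E (k0+n) (fun y => F y ω))) m x) := by
    intro m x
    induction m with
    | zero => exact hspω _ _
    | succ m ih => exact ih.max (hspω _ _)
  have hspj := fun m => D.joint_meas (k0 + (i+m:ℕ)) (fun x ω => sp l i (fun n => D.E (k0+n) (fun y => F y ω)) m x)
    (hspω m) (fun ω => hlevsp ω m)
  have hrmj := fun m => D.joint_meas (k0 + (i+m:ℕ)) (fun x ω => runMax (sp l i (fun n => D.E (k0+n) (fun y => F y ω))) m x)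
    (hrmω m) (fun ω => D.lev_runMax _ i (hlevsp ω) m)
  have hfin : IsFiniteMeasure (ν.restrict (D.A (k0+i) x0)) :=
    ⟨by rw [Measure.restrict_apply_univ, D.volA]; exact (D.v_ne_top _).lt_top⟩
  have hspb : ∀ m x, ∫⁻ ω, sp l i (fun n => D.E (k0+n) (fun y => F y ω)) m x ^ t ∂μ
      ≤ (8 * (D.c + 1) * D.E (k0+i) Fn x) ^ t := by
    intro m x
    induction m with
    | zero =>
      refine (D.E_mink μ hpq F hF Fn hFn _ x).trans ?_
      refine ENNReal.rpow_le_rpow ?_ ht.le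
      refine le_mul_of_one_le_left zero_le ?_
      calc (1:ℝ≥0∞) ≤ 8 * 1 := by norm_num
        _ ≤ _ := by gcongr; exact le_add_self
    | succ m ih =>
      simp only [sp]
      split_ifs with h
      · refine (D.E_mink μ hpq F hF Fn hFn _ x).trans ?_
        refine ENNReal.rpow_le_rpow ?_ ht.le
        have h1 := D.E_step (k0 + (i+m:ℕ)) Fn x
        have h2 := hbd _ _ _ h
        have e : k0 + ((i+m+1:ℕ):ℤ) = k0 + (i+m:ℕ) + 1 := by push_cast; ring
        rw [e]
        calc _ ≤ _ := h1
          _ ≤ D.c * (8 * D.E (k0+i) Fn x) := by gcongr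
          _ = 8 * D.c * D.E (k0+i) Fn x := by ring
          _ ≤ _ := by gcongr; exact le_self_add
      · exact ih
  rw [lintegral_lintegral_swap ((hrmj m).pow_const _).aemeasurable]
  calc ∫⁻ ω, ∫⁻ x in D.A (k0+i) x0, runMax (sp l i (fun n => D.E (k0+n) (fun y => F y ω))) m x ^ t ∂ν ∂μ
      ≤ ∫⁻ ω, C * ∫⁻ x in D.A (k0+i) x0, sp l i (fun n => D.E (k0+n) (fun y => F y ω)) m x ^ t ∂ν ∂μ := by
        apply lintegral_mono
        intro ω
        apply hd (ν.restrict (D.A (k0+i) x0)) _ B hB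
        · intro n x
          induction n with
          | zero => exact D.E_le_bound _ _ _ (fun y => hFB y ω) _
          | succ n ih =>
            simp only [sp]
            split_ifs
            · exact D.E_le_bound _ _ _ (fun y => hFB y ω) _
            · exact ih
        · exact fun n => (hlevsp ω n).measurable
        · intro n
          apply D.sp_mart l hl hanc i (hFω ω)
          intro x y h
          show _ ^ _ = _ ^ _
          rw [D.lev_runMax _ i (hlevsp ω) n x y h]
    _ = C * ∫⁻ x in D.A (k0+i) x0, ∫⁻ ω, sp l i (fun n => D.E (k0+n) (fun y => F y ω)) m x ^ t ∂μ ∂ν := by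
        rw [lintegral_const_mul' _ _ hC, lintegral_lintegral_swap]
        exact ((hspj m).pow_const _).comp measurable_swap |>.aemeasurable
    _ ≤ C * ∫⁻ x in D.A (k0+i) x0, (8 * (D.c + 1) * D.E (k0+i) Fn x0) ^ t ∂ν := by
        gcongr 1
        refine setLIntegral_mono measurable_const fun x hx => ?_
        refine (hspb m x).trans_eq ?_
        rw [D.lev_E (k0+i) Fn x x0 hx]
    _ = _ := by rw [setLIntegral_const, D.volA]

end Grid

lemma runMax_le' {X : Type*} {s : ℕ → X → ℝ≥0∞} {B : ℝ≥0∞} {x : X} (n : ℕ) (h : ∀ m ≤ n, s m x ≤ B) :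
    runMax s n x ≤ B := by
  induction n with
  | zero => exact h 0 le_rfl
  | succ n ih => exact max_le (ih fun m hm => h m (by omega)) (h _ le_rfl)

namespace Grid
variable {X : Type} [MeasurableSpace X] {ν : Measure X} {I : Type} (D : Grid X ν I)

lemma meas_E2 [SFinite ν] {Ω : Type} [MeasurableSpace Ω] {F : X → Ω → ℝ≥0∞} (hF : Measurable (Function.uncurry F))
    (k : ℤ) (x : X) : Measurable (fun ω => D.E k (fun y => F y ω) x) :=
  (Measurable.lintegral_prod_left' hF).div_const _

lemma meas_Ej [Countable I] [SFinite ν] {Ω : Type} [MeasurableSpace Ω] {F : X → Ω → ℝ≥0∞} (hF : Measurable (Function.uncurry F))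
    (k : ℤ) : Measurable (Function.uncurry fun x ω => D.E k (fun y => F y ω) x) :=
  D.joint_meas k _ (fun x => D.meas_E2 hF k x) (fun _ => D.lev_E k _)

lemma meas_rm [Countable I] [SFinite ν] {Ω : Type} [MeasurableSpace Ω] {F : X → Ω → ℝ≥0∞} (hF : Measurable (Function.uncurry F))
    {k0 : ℤ} (l : ℕ → X → ℕ) (hl : ∀ n : ℕ, D.Lev (k0+n) (l n)) (i m : ℕ) :
    Measurable (Function.uncurry fun x ω => runMax (sp l i (fun n => D.E (k0+n) (fun y => F y ω))) m x) := by
  have hlevsp : ∀ ω m, D.Lev (k0 + (i+m:ℕ)) (sp l i (fun n => D.E (k0+n) (fun y => F y ω)) m) :=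
    fun ω => D.lev_sp l hl i _ (fun n => D.lev_E _ _)
  have hspω : ∀ m x, Measurable (fun ω => sp l i (fun n => D.E (k0+n) (fun y => F y ω)) m x) := by
    intro m x
    induction m with
    | zero => exact D.meas_E2 hF _ _
    | succ m ih =>
      simp only [sp]
      split_ifs
      · exact D.meas_E2 hF _ _
      · exact ih
  have hrmω : ∀ m x, Measurable (fun ω => runMax (sp l i (fun n => D.E (k0+n) (fun y => F y ω))) m x) := by
    intro m x
    induction m with
    | zero => exact hspω _ _
    | succ m ih => exact ih.max (hspω _ _)
  exact D.joint_meas (k0 + (i+m:ℕ)) (fun x ω => runMax (sp l i (fun n => D.E (k0+n) (fun y => F y ω))) m x)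
    (hrmω m) (fun ω => D.lev_runMax _ i (hlevsp ω) m)

lemma prod_step [Countable I] {t q : ℝ} (hpq : t.HolderConjugate q) :
    ∃ C : ℝ≥0∞, C ≠ ∞ ∧ ∀ {X : Type} [MeasurableSpace X] {ν : Measure X} [SFinite ν] (D : Grid X ν I)
      {Ω : Type} [MeasurableSpace Ω] (μ : Measure Ω) [SigmaFinite μ]
      (F : X → Ω → ℝ≥0∞) (_ : Measurable (Function.uncurry F)) (B : ℝ≥0∞) (_ : B ≠ ∞)
      (_ : ∀ x ω, F x ω ≤ B) (Fn : X → ℝ≥0∞)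
      (_ : ∀ x, (∫⁻ ω, F x ω ^ t ∂μ) ^ (1/t) ≤ Fn x)
      (G : X → Ω → ℝ≥0∞) (_ : Measurable (Function.uncurry G)) (B' : ℝ≥0∞) (_ : B' ≠ ∞)
      (_ : ∀ x ω, G x ω ≤ B') (Gn : X → ℝ≥0∞)
      (_ : ∀ x, (∫⁻ ω, G x ω ^ q ∂μ) ^ (1/q) ≤ Gn x) (k0 : ℤ)
      (l : ℕ → X → ℕ) (_ : ∀ n : ℕ, D.Lev (k0+n) (l n))
      (_ : ∀ n m i x, l n x = i → i ≤ m → m ≤ n → l m x = i)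
      (_ : ∀ (n i : ℕ) x, l n x = i → D.E (k0+n) Fn x ≤ 8 * D.E (k0+i) Fn x)
      (_ : ∀ (n i : ℕ) x, l n x = i → D.E (k0+n) Gn x ≤ 8 * D.E (k0+i) Gn x)
      (i m : ℕ) (x0 : X),
      ∫⁻ x in D.A (k0+i) x0, ∫⁻ ω, runMax (sp l i (fun n => D.E (k0+n) (fun y => F y ω))) m x *
        runMax (sp l i (fun n => D.E (k0+n) (fun y => G y ω))) m x ∂μ ∂ν
        ≤ C * (8 * (D.c + 1)) ^ 2 * (D.E (k0+i) Fn x0 * D.E (k0+i) Gn x0 * D.v (k0+i)) := by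
  obtain ⟨C1, hC1, h1⟩ := half (I := I) hpq
  obtain ⟨C2, hC2, h2⟩ := half (I := I) hpq.symm
  have ht := hpq.pos
  have hq := hpq.symm.pos
  refine ⟨C1 ^ (1/t) * C2 ^ (1/q), ENNReal.mul_ne_top (ENNReal.rpow_ne_top_of_nonneg (by positivity) hC1)
    (ENNReal.rpow_ne_top_of_nonneg (by positivity) hC2), ?_⟩
  intro X _ ν _ D Ω _ μ _ F hF B hB hFB Fn hFn G hG B' hB' hGB Gn hGn k0 l hl hanc hbF hbG i m x0
  have k1 := h1 D μ F hF B hB hFB Fn hFn k0 l hl hanc hbF i m x0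
  have k2 := h2 D μ G hG B' hB' hGB Gn hGn k0 l hl hanc hbG i m x0
  have m1 := D.meas_rm hF l hl i m
  have m2 := D.meas_rm hG l hl i m
  set R1 : X → Ω → ℝ≥0∞ := fun x ω => runMax (sp l i (fun n => D.E (k0+n) (fun y => F y ω))) m x with hR1
  set R2 : X → Ω → ℝ≥0∞ := fun x ω => runMax (sp l i (fun n => D.E (k0+n) (fun y => G y ω))) m x with hR2
  set P := D.A (k0+i) x0
  have hH := ENNReal.lintegral_mul_le_Lp_mul_Lq ((ν.restrict P).prod μ) hpq m1.aemeasurable m2.aemeasurable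
  rw [lintegral_prod _ ((m1.pow_const _).aemeasurable), lintegral_prod _ ((m2.pow_const _).aemeasurable),
    lintegral_prod _ ((m1.mul m2).aemeasurable)] at hH
  refine hH.trans ?_
  have hv : D.v (k0+i) ^ (1/t) * D.v (k0+i) ^ (1/q) = D.v (k0+i) := by
    rw [← ENNReal.rpow_add _ _ (D.v_ne_zero _) (D.v_ne_top _), one_div, one_div, hpq.inv_add_inv_eq_one, ENNReal.rpow_one]
  have hr : ∀ (C a v : ℝ≥0∞) (s : ℝ), 0 < s → (C * (a ^ s * v)) ^ (1/s) = C ^ (1/s) * (a * v ^ (1/s)) := by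
    intro C a v s hs
    rw [ENNReal.mul_rpow_of_nonneg _ _ (by positivity), ENNReal.mul_rpow_of_nonneg _ _ (by positivity),
      ← ENNReal.rpow_mul, mul_one_div_cancel hs.ne', ENNReal.rpow_one]
  calc _ ≤ (C1 * ((8 * (D.c + 1) * D.E (k0+i) Fn x0) ^ t * D.v (k0+i))) ^ (1/t) *
        (C2 * ((8 * (D.c + 1) * D.E (k0+i) Gn x0) ^ q * D.v (k0+i))) ^ (1/q) := by
        gcongr
        · exact k1
        · exact k2
    _ = C1 ^ (1/t) * C2 ^ (1/q) * (8 * (D.c + 1)) ^ 2 * (D.E (k0+i) Fn x0 * D.E (k0+i) Gn x0 * 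
          (D.v (k0+i) ^ (1/t) * D.v (k0+i) ^ (1/q))) := by
        rw [hr _ _ _ _ ht, hr _ _ _ _ hq]
        ring
    _ = _ := by rw [hv]

lemma halt_small [Countable I] (k : ℤ) {f : X → ℝ≥0∞} (hf : Measurable f) (x : X) 
    (h0 : D.E k f x ≠ 0) (h1 : D.E k f x ≠ ∞) :
    8 * ν {y | y ∈ D.A k x ∧ ∃ n : ℕ, 8 * D.E k f x < D.E (k+n) f y} ≤ D.v k := by
  have h := D.weak k hf x (8 * D.E k f x)
  rw [← D.E_mul] at h
  rw [← ENNReal.mul_le_mul_iff_right h0 h1]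
  refine le_trans (le_of_eq ?_) h
  ring

lemma big [Countable I] (k : ℤ) {f g : X → ℝ≥0∞} (hf : Measurable f) (hg : Measurable g) (x : X) 
    (h0 : D.E k f x ≠ 0) (h1 : D.E k f x ≠ ∞) (h0' : D.E k g x ≠ 0) (h1' : D.E k g x ≠ ∞)
    (S : Set X) (hS : ∀ y ∈ D.A k x, (∀ n : ℕ, D.E (k+n) f y ≤ 8 * D.E k f x ∧ D.E (k+n) g y ≤ 8 * D.E k g x) → y ∈ S) :
    D.v k ≤ 2 * ν S := by
  have a1 := D.halt_small k hf x h0 h1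
  have a2 := D.halt_small k hg x h0' h1'
  set U1 := {y | y ∈ D.A k x ∧ ∃ n : ℕ, 8 * D.E k f x < D.E (k+n) f y}
  set U2 := {y | y ∈ D.A k x ∧ ∃ n : ℕ, 8 * D.E k g x < D.E (k+n) g y}
  have hsub : D.A k x ⊆ S ∪ (U1 ∪ U2) := by
    intro y hy
    by_cases h : ∀ n : ℕ, D.E (k+n) f y ≤ 8 * D.E k f x ∧ D.E (k+n) g y ≤ 8 * D.E k g x
    · exact Or.inl (hS y hy h)
    · push Not at h
      obtain ⟨n, h⟩ := h
      by_cases h3 : D.E (k+n) f y ≤ 8 * D.E k f x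
      · exact Or.inr (Or.inr ⟨hy, n, h h3⟩)
      · exact Or.inr (Or.inl ⟨hy, n, not_le.1 h3⟩)
  have h2 : D.v k ≤ ν S + (ν U1 + ν U2) := by
    rw [← D.volA k x]
    exact (measure_mono hsub).trans ((measure_union_le _ _).trans (by gcongr; exact measure_union_le _ _))
  have hv := D.v_ne_top k
  have u1 : ν U1 ≠ ∞ := by
    intro h; rw [h, ENNReal.mul_top (by norm_num), top_le_iff] at a1; exact hv a1
  have u2 : ν U2 ≠ ∞ := by
    intro h; rw [h, ENNReal.mul_top (by norm_num), top_le_iff] at a2; exact hv a2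
  by_cases hs : ν S = ∞
  · rw [hs, ENNReal.mul_top (by norm_num)]; exact le_top
  generalize ν U1 = u at *
  generalize ν U2 = w at *
  generalize ν S = s at *
  generalize D.v k = v at *
  lift u to NNReal using u1
  lift w to NNReal using u2
  lift s to NNReal using hs
  lift v to NNReal using hv
  norm_cast at *
  have hs0 : 0 ≤ (s:ℝ) := s.2
  have b1 : (8:ℝ) * u ≤ v := by exact_mod_cast a1
  have b2 : (8:ℝ) * w ≤ v := by exact_mod_cast a2
  have b3 : (v:ℝ) ≤ s + (u + w) := by exact_mod_cast h2
  have : (v:ℝ) ≤ 2 * s := by linarith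
  exact_mod_cast this

lemma lev_ell (a b : ℕ → X → ℝ≥0∞) {k0 : ℤ} (ha : ∀ n : ℕ, D.Lev (k0+n) (a n)) (hb : ∀ n : ℕ, D.Lev (k0+n) (b n)) (n : ℕ) :
    D.Lev (k0+n) (ell a b n) := by
  induction n with
  | zero => intro x y h; rfl
  | succ n ih =>
    intro x y h
    have h' : D.idx (k0 + (n:ℕ)) x = D.idx (k0 + (n:ℕ)) y := D.idx_le' (by push_cast; omega) h
    have hle := ell_le a b n y
    simp only [ell]
    rw [ih x y h', ha (n+1) x y h, hb (n+1) x y h, 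
      ha (ell a b n y) x y (D.idx_le' (by push_cast; omega) h), hb (ell a b n y) x y (D.idx_le' (by push_cast; omega) h)]

lemma main_N [Countable I] {t q : ℝ} (hpq : t.HolderConjugate q) :
    ∃ C : ℝ≥0∞, C ≠ ∞ ∧ ∀ {X : Type} [MeasurableSpace X] {ν : Measure X} [SFinite ν] (D : Grid X ν I)
      {Ω : Type} [MeasurableSpace Ω] (μ : Measure Ω) [SigmaFinite μ]
      (F : X → Ω → ℝ≥0∞) (_ : Measurable (Function.uncurry F)) (B : ℝ≥0∞) (_ : B ≠ ∞)
      (_ : ∀ x ω, F x ω ≤ B) (Fn : X → ℝ≥0∞) (_ : Measurable Fn)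
      (_ : ∀ x, (∫⁻ ω, F x ω ^ t ∂μ) ^ (1/t) ≤ Fn x)
      (G : X → Ω → ℝ≥0∞) (_ : Measurable (Function.uncurry G)) (B' : ℝ≥0∞) (_ : B' ≠ ∞)
      (_ : ∀ x ω, G x ω ≤ B') (Gn : X → ℝ≥0∞) (_ : Measurable Gn)
      (_ : ∀ x, (∫⁻ ω, G x ω ^ q ∂μ) ^ (1/q) ≤ Gn x)
      (_ : ∀ k x, D.E k Fn x ≠ ∞) (_ : ∀ k x, D.E k Gn x ≠ ∞) (k0 : ℤ) (N : ℕ),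
      ∫⁻ x, ∫⁻ ω, runMax (fun n x => D.E (k0+n) (fun y => F y ω) x * D.E (k0+n) (fun y => G y ω) x) N x ∂μ ∂ν
        ≤ C * (8 * (D.c + 1)) ^ 2 * 2 * ∫⁻ x, runMax (fun n x => D.E (k0+n) Fn x * D.E (k0+n) Gn x) N x ∂ν := by
  obtain ⟨C, hC, hmain⟩ := prod_step (I := I) hpq
  refine ⟨C, hC, ?_⟩
  intro X _ ν _ D Ω _ μ _ F hF B hB hFB Fn hFnm hFn G hG B' hB' hGB Gn hGnm hGn hXf hYf k0 N
  set a : ℕ → X → ℝ≥0∞ := fun n => D.E (k0+n) Fn with ha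
  set b : ℕ → X → ℝ≥0∞ := fun n => D.E (k0+n) Gn with hb
  set l := ell a b with hl
  have hlev : ∀ n : ℕ, D.Lev (k0+n) (l n) := D.lev_ell a b (fun n => D.lev_E _ _) (fun n => D.lev_E _ _)
  have hanc : ∀ n m i x, l n x = i → i ≤ m → m ≤ n → l m x = i := fun n m i x h h1 h2 => ell_anc a b h h1 h2
  have m1 := D.meas_rm hF l hlev
  have m2 := D.meas_rm hG l hlev
  have hp := hmain D μ F hF B hB hFB Fn hFn G hG B' hB' hGB Gn hGn k0 l hlev hanc
    (fun n i x h => (ell_bound a b h).1) (fun n i x h => (ell_bound a b h).2)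
  set R1 : ℕ → ℕ → X → Ω → ℝ≥0∞ := fun i m x ω => runMax (sp l i (fun n => D.E (k0+n) (fun y => F y ω))) m x with hR1
  set R2 : ℕ → ℕ → X → Ω → ℝ≥0∞ := fun i m x ω => runMax (sp l i (fun n => D.E (k0+n) (fun y => G y ω))) m x with hR2
  have hm : ∀ i m, Measurable (Function.uncurry fun x ω => R1 i m x ω * R2 i m x ω) := fun i m => (m1 i m).mul (m2 i m)
  have hlm : ∀ n, Measurable (l n) := fun n => (hlev n).measurable
  have hseg : ∀ i n, MeasurableSet {x | l n x = i} := fun i n => hlm n (measurableSet_singleton i)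
  set Z : ℕ → X → ℝ≥0∞ := fun i x => if l i x = i then ∫⁻ ω, R1 i (N-i) x ω * R2 i (N-i) x ω ∂μ else 0 with hZ
  have hZm : ∀ i, Measurable (Z i) := fun i => Measurable.ite (hseg i i) ((hm i _).lintegral_prod_right') measurable_const
  have hpt : ∀ x, ∫⁻ ω, runMax (fun n x => D.E (k0+n) (fun y => F y ω) x * D.E (k0+n) (fun y => G y ω) x) N x ∂μ
      ≤ ∑ i ∈ Finset.range (N+1), Z i x := by
    intro x
    have e : ∑ i ∈ Finset.range (N+1), Z i x = ∫⁻ ω, ∑ i ∈ Finset.range (N+1), 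
        (if l i x = i then R1 i (N-i) x ω * R2 i (N-i) x ω else 0) ∂μ := by
      rw [lintegral_finsetSum]
      · refine Finset.sum_congr rfl fun i _ => ?_
        simp only [hZ]
        split_ifs
        · rfl
        · simp
      · intro i _
        split_ifs
        · exact (hm i _).comp measurable_prodMk_left
        · exact measurable_const
    rw [e]
    apply lintegral_mono
    intro ω
    apply runMax_le'
    intro n hn
    have hin : l n x ≤ n := ell_le a b n x
    obtain ⟨i, hi⟩ : ∃ i, l n x = i := ⟨_, rfl⟩
    rw [hi] at hin
    have hii := hanc _ _ _ _ hi le_rfl hin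
    refine le_trans ?_ (Finset.single_le_sum (fun i _ => zero_le) (Finset.mem_range.2 (show i < N+1 by omega)))
    show _ ≤ if l i x = i then R1 i (N-i) x ω * R2 i (N-i) x ω else 0
    rw [if_pos hii]
    have hin' : i + (n-i) = n := by omega
    have s1 := sp_eq l i (fun n => D.E (k0+n) (fun y => F y ω)) hanc (n-i) x (by rw [hin']; exact hi)
    have s2 := sp_eq l i (fun n => D.E (k0+n) (fun y => G y ω)) hanc (n-i) x (by rw [hin']; exact hi)
    rw [hin'] at s1 s2
    rw [← s1, ← s2]
    exact mul_le_mul' (le_runMax _ (by omega) x) (le_runMax _ (by omega) x)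
  have hi : ∀ i ∈ Finset.range (N+1), ∫⁻ x, Z i x ∂ν ≤ 
      ∫⁻ x, (C * (8 * (D.c + 1)) ^ 2 * 2) * (if l N x = i then a i x * b i x else 0) ∂ν := by
    intro i hiN
    have hiN' : i ≤ N := by have := Finset.mem_range.1 hiN; omega
    apply D.lint_le (k0+i)
    intro x0
    have hiteM : Measurable (fun x => if l N x = i then a i x * b i x else 0) :=
      Measurable.ite (hseg i N) ((D.meas_E _ _).mul (D.meas_E _ _)) measurable_const
    by_cases h0 : l i x0 = i
    · calc ∫⁻ x in D.A (k0+i) x0, Z i x ∂ν ≤ ∫⁻ x in D.A (k0+i) x0, ∫⁻ ω, R1 i (N-i) x ω * R2 i (N-i) x ω ∂μ ∂ν := by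
            apply lintegral_mono
            intro x
            simp only [hZ]
            split_ifs
            · exact le_rfl
            · exact zero_le
        _ ≤ C * (8 * (D.c + 1)) ^ 2 * (a i x0 * b i x0 * D.v (k0+i)) := hp i _ x0
        _ ≤ C * (8 * (D.c + 1)) ^ 2 * (a i x0 * b i x0 * (2 * ν (D.A (k0+i) x0 ∩ {x | l N x = i}))) := by
            rcases eq_or_ne (a i x0) 0 with hz | hz
            · simp [hz]
            rcases eq_or_ne (b i x0) 0 with hz' | hz'
            · simp [hz']
            gcongr
            apply D.big (k0+i) hFnm hGnm x0 hz (hXf _ _) hz' (hYf _ _)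
            intro y hy hyy
            refine ⟨hy, ?_⟩
            by_contra hne
            have hyi : l i y = i := by rw [hlev i y x0 hy]; exact h0
            obtain ⟨n, hn⟩ := ell_halts a b hyi hiN' hne
            have := hyy n
            have e : k0 + ((i+n:ℕ):ℤ) = k0 + i + n := by push_cast; ring
            simp only [ha, hb, e] at hn
            rw [D.lev_E (k0+i) Fn y x0 hy, D.lev_E (k0+i) Gn y x0 hy] at hn
            rcases hn with hn | hn
            · exact absurd this.1 (not_le.2 hn)
            · exact absurd this.2 (not_le.2 hn)
        _ = (C * (8 * (D.c + 1)) ^ 2 * 2) * (∫⁻ x in D.A (k0+i) x0 ∩ {x | l N x = i}, a i x0 * b i x0 ∂ν) := by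
            rw [setLIntegral_const]; ring
        _ = (C * (8 * (D.c + 1)) ^ 2 * 2) * (∫⁻ x in D.A (k0+i) x0, (if l N x = i then a i x * b i x else 0) ∂ν) := by
            congr 1
            rw [Set.inter_comm, ← Measure.restrict_restrict (hseg i N), ← lintegral_indicator (hseg i N)]
            apply setLIntegral_congr_fun (D.measA _ _)
            intro y hy
            simp only [Set.indicator, Set.mem_ofPred_eq, ha, hb]
            rw [D.lev_E (k0+i) Fn y x0 hy, D.lev_E (k0+i) Gn y x0 hy]
        _ = _ := by rw [lintegral_const_mul _ hiteM]
    · have : ∫⁻ x in D.A (k0+i) x0, Z i x ∂ν = ∫⁻ x in D.A (k0+i) x0, 0 ∂ν := by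
        apply setLIntegral_congr_fun (D.measA _ _)
        intro y hy
        show (if l i y = i then _ else _) = _
        rw [if_neg]
        rw [hlev i y x0 hy]; exact h0
      rw [this]; simp
  calc _ ≤ ∫⁻ x, ∑ i ∈ Finset.range (N+1), Z i x ∂ν := lintegral_mono hpt
    _ = ∑ i ∈ Finset.range (N+1), ∫⁻ x, Z i x ∂ν := lintegral_finsetSum _ (fun i _ => hZm i)
    _ ≤ ∑ i ∈ Finset.range (N+1), ∫⁻ x, (C * (8 * (D.c + 1)) ^ 2 * 2) * (if l N x = i then a i x * b i x else 0) ∂ν :=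
      Finset.sum_le_sum hi
    _ = ∫⁻ x, ∑ i ∈ Finset.range (N+1), (C * (8 * (D.c + 1)) ^ 2 * 2) * (if l N x = i then a i x * b i x else 0) ∂ν := by
      rw [lintegral_finsetSum]
      intro i _
      exact (Measurable.ite (hseg i N) ((D.meas_E _ _).mul (D.meas_E _ _)) measurable_const).const_mul _
    _ ≤ ∫⁻ x, (C * (8 * (D.c + 1)) ^ 2 * 2) * runMax (fun n x => D.E (k0+n) Fn x * D.E (k0+n) Gn x) N x ∂ν := by
      apply lintegral_mono
      intro x
      simp only
      rw [← Finset.mul_sum, Finset.sum_ite_eq]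
      split_ifs
      · gcongr
        exact le_runMax (fun n x => D.E (k0+n) Fn x * D.E (k0+n) Gn x) (ell_le a b N x) x
      · simp
    _ = _ := by
      rw [lintegral_const_mul]
      exact runMax_measurable (fun n => (D.meas_E _ _).mul (D.meas_E _ _)) N

end Grid

lemma runMax_uncurry {X Ω : Type*} (f : ℕ → X → Ω → ℝ≥0∞) (N : ℕ) (x : X) (ω : Ω) :
    runMax (fun n x => f n x ω) N x = runMax (fun n (p : X × Ω) => f n p.1 p.2) N (x, ω) := by
  induction N with
  | zero => rfl
  | succ N ih => simp only [runMax, ih]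

namespace Grid

lemma main_sup {I : Type} [Countable I] {t q : ℝ} (hpq : t.HolderConjugate q) :
    ∃ C : ℝ≥0∞, C ≠ ∞ ∧ ∀ {X : Type} [MeasurableSpace X] {ν : Measure X} [SFinite ν] (D : Grid X ν I)
      {Ω : Type} [MeasurableSpace Ω] (μ : Measure Ω) [SigmaFinite μ]
      (F : X → Ω → ℝ≥0∞) (_ : Measurable (Function.uncurry F)) (B : ℝ≥0∞) (_ : B ≠ ∞)
      (_ : ∀ x ω, F x ω ≤ B) (Fn : X → ℝ≥0∞) (_ : Measurable Fn)
      (_ : ∀ x, (∫⁻ ω, F x ω ^ t ∂μ) ^ (1/t) ≤ Fn x)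
      (G : X → Ω → ℝ≥0∞) (_ : Measurable (Function.uncurry G)) (B' : ℝ≥0∞) (_ : B' ≠ ∞)
      (_ : ∀ x ω, G x ω ≤ B') (Gn : X → ℝ≥0∞) (_ : Measurable Gn)
      (_ : ∀ x, (∫⁻ ω, G x ω ^ q ∂μ) ^ (1/q) ≤ Gn x)
      (_ : ∀ k x, D.E k Fn x ≠ ∞) (_ : ∀ k x, D.E k Gn x ≠ ∞),
      ∫⁻ x, ∫⁻ ω, (⨆ k : ℤ, D.E k (fun y => F y ω) x * D.E k (fun y => G y ω) x) ∂μ ∂ν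
        ≤ C * (8 * (D.c + 1)) ^ 2 * 2 * ∫⁻ x, (⨆ k : ℤ, D.E k Fn x * D.E k Gn x) ∂ν := by
  obtain ⟨C, hC, h⟩ := main_N (I := I) hpq
  refine ⟨C, hC, ?_⟩
  intro X _ ν _ D Ω _ μ _ F hF B hB hFB Fn hFnm hFn G hG B' hB' hGB Gn hGnm hGn hXf hYf
  set M : ℕ → X → Ω → ℝ≥0∞ := fun N x ω => 
    runMax (fun n x => D.E (-(N:ℤ)+n) (fun y => F y ω) x * D.E (-(N:ℤ)+n) (fun y => G y ω) x) (2*N) x with hM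
  have hMm : ∀ N, Measurable (Function.uncurry (M N)) := by
    intro N
    have : Function.uncurry (M N) = runMax (fun n (p : X × Ω) => 
      D.E (-(N:ℤ)+n) (fun y => F y p.2) p.1 * D.E (-(N:ℤ)+n) (fun y => G y p.2) p.1) (2*N) := by
      ext ⟨x, ω⟩
      exact runMax_uncurry (fun n x ω => D.E (-(N:ℤ)+n) (fun y => F y ω) x * D.E (-(N:ℤ)+n) (fun y => G y ω) x) _ _ _
    rw [this]
    exact runMax_measurable (fun n => (D.meas_Ej hF _).mul (D.meas_Ej hG _)) _
  have hmono : ∀ x ω, Monotone (fun N => M N x ω) := by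
    intro x ω
    apply monotone_nat_of_le_succ
    intro N
    apply runMax_le'
    intro m hm
    have := le_runMax (fun n x => D.E (-((N+1:ℕ):ℤ)+n) (fun y => F y ω) x * D.E (-((N+1:ℕ):ℤ)+n) (fun y => G y ω) x)
      (show m+1 ≤ 2*(N+1) by omega) x
    refine le_trans (le_of_eq ?_) this
    have e : -((N+1:ℕ):ℤ)+((m+1:ℕ):ℤ) = -(N:ℤ) + m := by push_cast; ring
    simp only [e]
  have hsup : ∀ x ω, (⨆ k : ℤ, D.E k (fun y => F y ω) x * D.E k (fun y => G y ω) x) ≤ ⨆ N, M N x ω := by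
    intro x ω
    apply iSup_le
    intro k
    refine le_trans ?_ (le_iSup _ k.natAbs)
    have := le_runMax (fun n x => D.E (-((k.natAbs:ℕ):ℤ)+n) (fun y => F y ω) x * D.E (-((k.natAbs:ℕ):ℤ)+n) (fun y => G y ω) x)
      (show (k + k.natAbs).toNat ≤ 2*k.natAbs by omega) x
    refine le_trans (le_of_eq ?_) this
    have e : -((k.natAbs:ℕ):ℤ)+((k + k.natAbs).toNat:ℤ) = k := by omega
    simp only [e]
  calc _ ≤ ∫⁻ x, ∫⁻ ω, ⨆ N, M N x ω ∂μ ∂ν := lintegral_mono fun x => lintegral_mono fun ω => hsup x ω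
    _ = ∫⁻ x, ⨆ N, ∫⁻ ω, M N x ω ∂μ ∂ν := by
      congr 1
      ext x
      have hm1 : ∀ N, Measurable (fun ω => M N x ω) := fun N => (hMm N).comp measurable_prodMk_left
      rw [lintegral_iSup hm1]
      exact fun i j hij ω => hmono x ω hij
    _ = ⨆ N, ∫⁻ x, ∫⁻ ω, M N x ω ∂μ ∂ν := by
      have hm1 : ∀ N, Measurable (fun x => ∫⁻ ω, M N x ω ∂μ) := fun N => (hMm N).lintegral_prod_right'
      rw [lintegral_iSup hm1]
      exact fun i j hij x => lintegral_mono fun ω => hmono x ω hij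
    _ ≤ _ := by
      apply iSup_le
      intro N
      refine (h D μ F hF B hB hFB Fn hFnm hFn G hG B' hB' hGB Gn hGnm hGn hXf hYf (-(N:ℤ)) (2*N)).trans ?_
      gcongr with x
      apply runMax_le'
      intro m hm
      exact le_iSup (fun k : ℤ => D.E k Fn x * D.E k Gn x) (-(N:ℤ)+m)

variable {X : Type} [MeasurableSpace X] {ν : Measure X} {I : Type} (D : Grid X ν I)

/-- average over an atom given by index -/
def EI (f : X → ℝ≥0∞) (p : ℤ × I) : ℝ≥0∞ := (∫⁻ y in D.idx p.1 ⁻¹' {p.2}, f y ∂ν) / D.v p.1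

lemma scalar [Countable I] (f g : X → ℝ≥0∞) (hf : Measurable f) (hg : Measurable g) (hfi : ∫⁻ x, f x ∂ν ≠ ∞)
    (hgi : ∫⁻ x, g x ∂ν ≠ ∞) (hv : ∀ M : ℝ≥0∞, M ≠ ∞ → ∃ K : ℤ, ∀ k ≤ K, M ≤ D.v k) (hc : 1 ≤ D.c) :
    ∃ (S : Set (ℤ × I)) (Es : ℤ × I → Set X), (∀ p ∈ S, (∃ x, D.idx p.1 x = p.2) ∧ MeasurableSet (Es p) ∧ 
        Es p ⊆ D.idx p.1 ⁻¹' {p.2} ∧ D.v p.1 ≤ 2 * ν (Es p)) ∧ S.PairwiseDisjoint Es ∧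
      ∫⁻ x, (⨆ k : ℤ, D.E k f x * D.E k g x) ∂ν ≤ 64 * D.c ^ 2 * ∑' p : S, D.EI f p * D.EI g p * D.v (p : ℤ × I).1 := by
  set V : ℤ → X → ℝ≥0∞ := fun k x => D.E k f x * D.E k g x with hV
  have hlev : ∀ k, D.Lev k (V k) := by
    intro k x y h
    simp only [hV]
    rw [D.lev_E k f x y h, D.lev_E k g x y h]
  have hEf : ∀ k x, D.E k f x ≠ ∞ := fun k x => ENNReal.div_ne_top
    (ne_top_of_le_ne_top hfi (setLIntegral_le_lintegral _ _)) (D.v_ne_zero k)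
  have hEg : ∀ k x, D.E k g x ≠ ∞ := fun k x => ENNReal.div_ne_top
    (ne_top_of_le_ne_top hgi (setLIntegral_le_lintegral _ _)) (D.v_ne_zero k)
  set a : ℝ≥0∞ := 64 * D.c ^ 2 with ha
  have ha1 : 1 < a := by
    calc (1:ℝ≥0∞) < 64 * 1 ^ 2 := by norm_num
      _ ≤ a := by rw [ha]; gcongr
  have hatop : a ≠ ∞ := ENNReal.mul_ne_top (by norm_num) (ENNReal.pow_ne_top D.c_top)
  have ha0 : a ≠ 0 := (zero_lt_one.trans ha1).ne'
  have hdecay : ∀ x (e : ℝ≥0∞), e ≠ 0 → ∃ K : ℤ, ∀ k ≤ K, V k x ≤ e := by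
    intro x e he
    rcases eq_or_ne e ∞ with het | het
    · exact ⟨0, fun k _ => het ▸ le_top⟩
    obtain ⟨K, hK⟩ := hv ((∫⁻ x, f x ∂ν) * (∫⁻ x, g x ∂ν) / e + 1) 
      (ENNReal.add_ne_top.2 ⟨ENNReal.div_ne_top (ENNReal.mul_ne_top hfi hgi) he, by norm_num⟩)
    refine ⟨K, fun k hk => ?_⟩
    have h1 := hK k hk
    have h2 : (∫⁻ x, f x ∂ν) * (∫⁻ x, g x ∂ν) / e ≤ D.v k := le_self_add.trans h1
    have h3 : 1 ≤ D.v k := le_add_self.trans h1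
    rw [ENNReal.div_le_iff he het] at h2
    calc V k x ≤ ((∫⁻ x, f x ∂ν) / D.v k) * ((∫⁻ x, g x ∂ν) / 1) := by
          simp only [hV, E]
          gcongr
          · exact Measure.restrict_le_self
          · exact Measure.restrict_le_self
      _ = (∫⁻ x, f x ∂ν) * (∫⁻ x, g x ∂ν) / D.v k := by
          rw [div_one, div_eq_mul_inv, div_eq_mul_inv]; ring
      _ ≤ e := by
          rw [ENNReal.div_le_iff (D.v_ne_zero k) (D.v_ne_top k), mul_comm e]
          exact h2
  refine ⟨{p | ∃ x, D.idx p.1 x = p.2 ∧ ∃ j : ℤ, a ^ j < V p.1 x ∧ ∀ k' < p.1, V k' x ≤ a ^ j},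
    fun p => {y | D.idx p.1 y = p.2 ∧ ∀ n : ℕ, D.E (p.1+n) f y ≤ 8 * D.E p.1 f y ∧ D.E (p.1+n) g y ≤ 8 * D.E p.1 g y},
    ?_, ?_, ?_⟩
  · rintro ⟨k, i⟩ ⟨x, hx, j, hj, -⟩
    simp only at hx hj
    refine ⟨⟨x, hx⟩, ?_, fun y hy => hy.1, ?_⟩
    · have e : {y | D.idx k y = i ∧ ∀ n : ℕ, D.E (k+n) f y ≤ 8 * D.E k f y ∧ D.E (k+n) g y ≤ 8 * D.E k g y} =
        (D.idx k ⁻¹' {i}) ∩ ⋂ n : ℕ, ({y | D.E (k+n) f y ≤ 8 * D.E k f y} ∩ {y | D.E (k+n) g y ≤ 8 * D.E k g y}) := by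
        ext y; simp
      show MeasurableSet {y | D.idx k y = i ∧ ∀ n : ℕ, D.E (k+n) f y ≤ 8 * D.E k f y ∧ D.E (k+n) g y ≤ 8 * D.E k g y}
      rw [e]
      refine (D.meas k i).inter (MeasurableSet.iInter fun n => MeasurableSet.inter ?_ ?_)
      · exact measurableSet_le (D.meas_E _ _) ((D.meas_E _ _).const_mul _)
      · exact measurableSet_le (D.meas_E _ _) ((D.meas_E _ _).const_mul _)
    · have hne : V k x ≠ 0 := (lt_of_le_of_lt zero_le hj).ne'
      have h1 : D.E k f x ≠ 0 := left_ne_zero_of_mul hne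
      have h2 : D.E k g x ≠ 0 := right_ne_zero_of_mul hne
      apply D.big k hf hg x h1 (hEf _ _) h2 (hEg _ _)
      intro y hy hyy
      have hy' : D.idx k y = D.idx k x := hy
      refine ⟨hy'.trans hx, ?_⟩
      rw [D.lev_E k f y x hy, D.lev_E k g y x hy]
      exact hyy
  · have key : ∀ (k k' : ℤ) (y : X), k < k' → (∃ j : ℤ, a ^ j < V k y ∧ ∀ k'' < k, V k'' y ≤ a ^ j) →
        (∃ j : ℤ, a ^ j < V k' y ∧ ∀ k'' < k', V k'' y ≤ a ^ j) → 
        (∀ n : ℕ, D.E (k+n) f y ≤ 8 * D.E k f y ∧ D.E (k+n) g y ≤ 8 * D.E k g y) → False := by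
      rintro k k' y hkk ⟨j, hj1, hj2⟩ ⟨j', hj1', hj2'⟩ hy
      have h1 : a ^ j < a ^ j' := hj1.trans_le (hj2' k hkk)
      have h2 : j + 1 ≤ j' := by
        by_contra hcon
        exact absurd (ENNReal.zpow_le_of_le ha1.le (show j' ≤ j by omega)) (not_le.2 h1)
      have h3 : a ^ (j+1) ≤ a ^ j' := ENNReal.zpow_le_of_le ha1.le h2
      rw [ENNReal.zpow_add ha0 hatop, zpow_one] at h3
      have h4 : V k y ≤ D.c ^ 2 * V (k-1) y := by
        have e1 := D.E_step (k-1) f y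
        have e2 := D.E_step (k-1) g y
        rw [sub_add_cancel] at e1 e2
        calc V k y ≤ (D.c * D.E (k-1) f y) * (D.c * D.E (k-1) g y) := mul_le_mul' e1 e2
          _ = _ := by simp only [hV]; ring
      have h5 := hj2 (k-1) (by omega)
      have h6 : V k' y ≤ 64 * V k y := by
        obtain ⟨e1, e2⟩ := hy (k'-k).toNat
        have e : k + ((k'-k).toNat : ℤ) = k' := by omega
        rw [e] at e1 e2
        calc V k' y ≤ (8 * D.E k f y) * (8 * D.E k g y) := mul_le_mul' e1 e2
          _ = 64 * V k y := by simp only [hV]; ring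
      have : V k' y ≤ a ^ j' := by
        calc V k' y ≤ 64 * (D.c ^ 2 * a ^ j) := h6.trans (by gcongr; exact h4.trans (by gcongr))
          _ = a ^ j * a := by rw [ha]; ring
          _ ≤ _ := h3
      exact absurd hj1' (not_lt.2 this)
    have hS : ∀ (p : ℤ × I) (y : X), (∃ x, D.idx p.1 x = p.2 ∧ ∃ j : ℤ, a ^ j < V p.1 x ∧ ∀ k' < p.1, V k' x ≤ a ^ j) →
        D.idx p.1 y = p.2 → (∃ j : ℤ, a ^ j < V p.1 y ∧ ∀ k'' < p.1, V k'' y ≤ a ^ j) := by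
      rintro p y ⟨x, hx, j, hj1, hj2⟩ hy
      have hxy := hy.trans hx.symm
      refine ⟨j, ?_, ?_⟩
      · rw [hlev _ y x hxy]; exact hj1
      · intro k' hk'
        rw [hlev _ y x (D.idx_le' hk'.le hxy)]; exact hj2 k' hk'
    intro p hp p' hp' hne
    rw [Function.onFun, Set.disjoint_left]
    intro y hy hy'
    have q1 := hS p y hp hy.1
    have q2 := hS p' y hp' hy'.1
    rcases lt_trichotomy p.1 p'.1 with h | h | h
    · exact key _ _ y h q1 q2 hy.2
    · apply hne
      refine Prod.ext h ?_
      rw [← hy.1, ← hy'.1, h]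
    · exact key _ _ y h q2 q1 hy'.2
  · set S : Set (ℤ × I) := {p | ∃ x, D.idx p.1 x = p.2 ∧ ∃ j : ℤ, a ^ j < V p.1 x ∧ ∀ k' < p.1, V k' x ≤ a ^ j} with hSd
    have hpt : ∀ x, (⨆ k : ℤ, V k x) ≤ ∑' p : S, (D.idx (p:ℤ × I).1 ⁻¹' {(p:ℤ × I).2}).indicator
        (fun _ => a * (D.EI f p * D.EI g p)) x := by
      intro x
      apply iSup_le
      intro k
      rcases eq_or_ne (V k x) 0 with h0 | h0
      · rw [h0]; exact zero_le
      obtain ⟨j, hj1, hj2⟩ := ENNReal.exists_mem_Ioc_zpow h0 (ENNReal.mul_ne_top (hEf k x) (hEg k x)) ha1 hatop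
      obtain ⟨K, hK⟩ := hdecay x (a ^ j) (ENNReal.zpow_pos ha0 hatop j).ne'
      obtain ⟨m, hm1, hm2⟩ := Int.exists_least_of_bdd (P := fun k => a ^ j < V k x) 
        ⟨K, fun z hz => by
          by_contra hcon
          exact absurd hz (not_lt.2 (hK z (by omega)))⟩ ⟨k, hj1⟩
      have hmem : (m, D.idx m x) ∈ S := ⟨x, rfl, j, hm1, fun k' hk' => by
        by_contra hcon
        have := hm2 k' (not_le.1 hcon)
        simp only at hk'
        omega⟩
      refine le_trans ?_ (ENNReal.le_tsum (⟨(m, D.idx m x), hmem⟩ : S))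
      rw [Set.indicator_of_mem (show x ∈ D.idx m ⁻¹' {D.idx m x} from rfl)]
      calc V k x ≤ a ^ (j+1) := hj2
        _ = a * a ^ j := by rw [ENNReal.zpow_add ha0 hatop, zpow_one, mul_comm]
        _ ≤ a * V m x := by gcongr
        _ = _ := rfl
    calc ∫⁻ x, (⨆ k : ℤ, V k x) ∂ν ≤ ∫⁻ x, ∑' p : S, (D.idx (p:ℤ × I).1 ⁻¹' {(p:ℤ × I).2}).indicator
            (fun _ => a * (D.EI f p * D.EI g p)) x ∂ν := lintegral_mono hpt
      _ = ∑' p : S, ∫⁻ x, (D.idx (p:ℤ × I).1 ⁻¹' {(p:ℤ × I).2}).indicator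
            (fun _ => a * (D.EI f p * D.EI g p)) x ∂ν := 
          lintegral_tsum fun p => (measurable_const.indicator (D.meas _ _)).aemeasurable
      _ = ∑' p : S, a * (D.EI f p * D.EI g p * D.v (p : ℤ × I).1) := by
          congr 1
          ext p
          rw [lintegral_indicator (D.meas _ _), setLIntegral_const]
          obtain ⟨x, hx, -⟩ := p.2
          rw [← hx, D.vol]
          ring
      _ = _ := ENNReal.tsum_mul_left

end Grid

lemma cube_set_eq {d : ℕ} (Q : Cube d) : Q.set = Set.univ.pi (fun i => Set.Ico (Q.corner i) (Q.corner i + Q.side)) := by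
  ext x; simp [Cube.set, Set.mem_pi]

lemma cube_vol {d : ℕ} (Q : Cube d) : Q.vol = ENNReal.ofReal Q.side ^ d := by
  rw [Cube.vol, cube_set_eq, Real.volume_pi_Ico]
  simp

lemma cube_meas {d : ℕ} (Q : Cube d) : MeasurableSet Q.set := by
  rw [cube_set_eq]
  exact MeasurableSet.univ_pi fun i => measurableSet_Ico

/-- shift -/
def shft {d : ℕ} (b : Fin d → Bool) (k : ℤ) (i : Fin d) : ℝ :=
  if b i = true then (if Even k then 1/3 else -1/3) else 0

lemma shft_succ {d : ℕ} (b : Fin d → Bool) (k : ℤ) (i : Fin d) : shft b (k+1) i = - shft b k i := by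
  simp only [shft, Int.even_add_one]
  by_cases h : b i = true <;> by_cases h2 : Even k <;> simp [h, h2]
  all_goals ring

lemma shft_int {d : ℕ} (b : Fin d → Bool) (k : ℤ) (i : Fin d) : ∃ z : ℤ, 3 * shft b k i = z := by
  simp only [shft]
  split_ifs
  · exact ⟨1, by norm_num⟩
  · exact ⟨-1, by norm_num⟩
  · exact ⟨0, by norm_num⟩

lemma floor_half (y : ℝ) : ⌊y⌋ = ⌊2*y⌋ / 2 := by
  rw [Int.floor_eq_iff]
  have h1 := Int.floor_le (2*y)
  have h2 := Int.lt_floor_add_one (2*y)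
  set n := ⌊2*y⌋
  have h3 : 2 * (n/2) ≤ n := by omega
  have h4 : n ≤ 2 * (n/2) + 1 := by omega
  have h3' : 2 * ((n/2 : ℤ):ℝ) ≤ n := by exact_mod_cast h3
  have h4' : (n:ℝ) ≤ 2 * ((n/2 : ℤ):ℝ) + 1 := by exact_mod_cast h4
  constructor <;> linarith

def gidx {d : ℕ} (b : Fin d → Bool) (k : ℤ) (x : Fin d → ℝ) (i : Fin d) : ℤ := ⌊(2:ℝ)^k * x i - shft b k i⌋

def gcube {d : ℕ} (b : Fin d → Bool) (k : ℤ) (m : Fin d → ℤ) : Cube d where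
  corner i := (2:ℝ)^(-k) * (m i + shft b k i)
  side := (2:ℝ)^(-k)
  side_pos := by positivity

lemma gcube_set {d : ℕ} (b : Fin d → Bool) (k : ℤ) (m : Fin d → ℤ) : (gcube b k m).set = gidx b k ⁻¹' {m} := by
  ext x
  simp only [Cube.set, gcube, Set.mem_ofPred_eq, Set.mem_preimage, Set.mem_singleton_iff, funext_iff, gidx, Int.floor_eq_iff]
  refine forall_congr' fun i => ?_
  have hp : (0:ℝ) < 2^k := by positivity
  rw [zpow_neg]
  generalize (2:ℝ)^k = p at hp
  constructor
  · rintro ⟨h1, h2⟩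
    rw [inv_mul_le_iff₀ hp] at h1
    have h3 : x i < p⁻¹ * (m i + shft b k i + 1) := by rw [mul_add, mul_one]; exact h2
    rw [lt_inv_mul_iff₀ hp] at h3
    constructor <;> linarith
  · rintro ⟨h1, h2⟩
    constructor
    · rw [inv_mul_le_iff₀ hp]; linarith
    · have h3 : x i < p⁻¹ * (m i + shft b k i + 1) := by rw [lt_inv_mul_iff₀ hp]; linarith
      rw [mul_add, mul_one] at h3; exact h3

def dgrid {d : ℕ} (b : Fin d → Bool) : Grid (Fin d → ℝ) volume (Fin d → ℤ) where
  idx := gidx b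
  meas k i := by rw [← gcube_set]; exact cube_meas _
  refine' k x y h := by
    funext i
    have h := congrFun h i
    simp only [gidx] at h ⊢
    obtain ⟨z, hz⟩ := shft_int b k i
    have e : ∀ w : ℝ, (2:ℝ)^(k+1) * w - shft b (k+1) i = 2 * ((2:ℝ)^k * w - shft b k i) + z := by
      intro w
      rw [shft_succ, ← hz, zpow_add₀ (by norm_num), zpow_one]; ring
    rw [e, e, Int.floor_add_intCast, Int.floor_add_intCast] at h
    rw [floor_half ((2:ℝ)^k * x i - _), floor_half ((2:ℝ)^k * y i - _)]
    congr 1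
    omega
  v k := ENNReal.ofReal ((2:ℝ)^(-k)) ^ d
  c := 2 ^ d
  c_top := by finiteness
  v_ne_zero k := by
    apply pow_ne_zero
    rw [ne_eq, ENNReal.ofReal_eq_zero, not_le]; positivity
  v_ne_top k := by finiteness
  vol k x := by
    rw [← gcube_set]
    exact cube_vol _
  v_step k := by
    rw [← mul_pow]
    gcongr
    rw [show (2:ℝ≥0∞) = ENNReal.ofReal 2 by simp, ← ENNReal.ofReal_mul (by norm_num)]
    apply ENNReal.ofReal_le_ofReal
    rw [neg_add, zpow_add₀ (by norm_num)]
    norm_num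
    linarith

lemma dgrid_v {d : ℕ} (hd : 1 ≤ d) (b : Fin d → Bool) (M : ℝ≥0∞) (hM : M ≠ ∞) : ∃ K : ℤ, ∀ k ≤ K, M ≤ (dgrid b).v k := by
  obtain ⟨n, hn⟩ := ENNReal.exists_nat_gt hM
  refine ⟨-n, fun k hk => ?_⟩
  show M ≤ ENNReal.ofReal ((2:ℝ)^(-k)) ^ d
  have h1 : (2:ℝ)^(n:ℤ) ≤ (2:ℝ)^(-k) := zpow_le_zpow_right₀ (by norm_num) (by omega)
  rw [zpow_natCast] at h1
  have h2 : (1:ℝ) ≤ 2^n := one_le_pow₀ (by norm_num)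
  have h3 : (n:ℝ) ≤ 2^n := by exact_mod_cast Nat.lt_two_pow_self.le
  have h4 : (1:ℝ≥0∞) ≤ ENNReal.ofReal ((2:ℝ)^(-k)) := by
    rw [← ENNReal.ofReal_one]; exact ENNReal.ofReal_le_ofReal (h2.trans h1)
  calc M ≤ n := hn.le
    _ = ENNReal.ofReal n := by simp
    _ ≤ ENNReal.ofReal ((2:ℝ)^(-k)) := ENNReal.ofReal_le_ofReal (h3.trans h1)
    _ ≤ _ := le_self_pow h4 (by omega)

lemma cover1 (e : Bool) (u w : ℝ) (hw : w ≤ 1/3) : ∃ b : Bool, ∀ y, u ≤ y → y < u + w → 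
    ⌊y - (if b = true then (if e = true then 1/3 else -1/3) else 0)⌋ = ⌊u - (if b = true then (if e = true then 1/3 else -1/3) else 0)⌋ := by
  have h1 := Int.floor_le u
  have h2 := Int.lt_floor_add_one u
  set n := ⌊u⌋ with hn
  by_cases h : u - n ≤ 2/3
  · refine ⟨false, fun y hy1 hy2 => ?_⟩
    simp only [Bool.false_eq_true, if_false, sub_zero]
    rw [← hn, Int.floor_eq_iff]
    constructor <;> linarith
  · refine ⟨true, fun y hy1 hy2 => ?_⟩
    simp only [if_true]
    push Not at h
    cases e
    · have : ⌊u - (if false = true then (1/3:ℝ) else -1/3)⌋ = n + 1 := by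
        rw [Int.floor_eq_iff]
        push_cast
        norm_num
        constructor <;> linarith
      rw [this, Int.floor_eq_iff]
      push_cast
      norm_num
      constructor <;> linarith
    · have : ⌊u - (if true = true then (1/3:ℝ) else -1/3)⌋ = n := by
        rw [Int.floor_eq_iff]
        norm_num
        constructor <;> linarith
      rw [this, Int.floor_eq_iff]
      norm_num
      constructor <;> linarith

lemma cover {d : ℕ} (Q : Cube d) : ∃ (b : Fin d → Bool) (k : ℤ), Q.set ⊆ (dgrid b).A k Q.corner ∧ 
    (dgrid b).v k ≤ 6 ^ d * Q.vol := by
  obtain ⟨n, hn1, hn2⟩ := exists_mem_Ioc_zpow (x := 3 * Q.side) (y := (2:ℝ)) (by linarith [Q.side_pos]) (by norm_num)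
  set k := -(n+1) with hk
  have hp : (0:ℝ) < 2^k := by positivity
  have hkn : (2:ℝ)^k * (2:ℝ)^(n+1) = 1 := by rw [← zpow_add₀ (by norm_num)]; simp [hk]
  have hw : (2:ℝ)^k * Q.side ≤ 1/3 := by
    have := mul_le_mul_of_nonneg_left hn2 hp.le
    rw [hkn] at this
    linarith
  have := fun i => cover1 (decide (Even k)) ((2:ℝ)^k * Q.corner i) ((2:ℝ)^k * Q.side) hw
  choose b hb using this
  refine ⟨b, k, ?_, ?_⟩
  · intro x hx
    show gidx b k x = gidx b k Q.corner
    funext i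
    have := hb i ((2:ℝ)^k * x i) (mul_le_mul_of_nonneg_left (hx i).1 hp.le) (by
      rw [← mul_add]; exact mul_lt_mul_of_pos_left (hx i).2 hp)
    simpa only [gidx, shft, decide_eq_true_eq] using this
  · show ENNReal.ofReal ((2:ℝ)^(-k)) ^ d ≤ _
    rw [cube_vol, ← mul_pow]
    gcongr
    rw [show (6:ℝ≥0∞) = ENNReal.ofReal 6 by simp, ← ENNReal.ofReal_mul (by norm_num)]
    apply ENNReal.ofReal_le_ofReal
    rw [hk, neg_neg, zpow_add₀ (by norm_num), zpow_one]
    linarith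

lemma avg_one {d : ℕ} (f : (Fin d → ℝ) → ℝ≥0∞) (Q : Cube d) : avg 1 f Q = (∫⁻ x in Q.set, f x) / Q.vol := by
  simp [avg]

lemma vol_ne_zero {d : ℕ} (Q : Cube d) : Q.vol ≠ 0 := by
  rw [cube_vol]
  apply pow_ne_zero
  rw [ne_eq, ENNReal.ofReal_eq_zero, not_le]; exact Q.side_pos

lemma vol_ne_top {d : ℕ} (Q : Cube d) : Q.vol ≠ ∞ := by
  rw [cube_vol]; finiteness

lemma avg_le {d : ℕ} (f : (Fin d → ℝ) → ℝ≥0∞) (Q : Cube d) (b : Fin d → Bool) (k : ℤ)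
    (h1 : Q.set ⊆ (dgrid b).A k Q.corner) (h2 : (dgrid b).v k ≤ 6 ^ d * Q.vol) :
    avg 1 f Q ≤ 6 ^ d * (dgrid b).E k f Q.corner := by
  rw [avg_one, ENNReal.div_le_iff (vol_ne_zero Q) (vol_ne_top Q)]
  calc ∫⁻ x in Q.set, f x ≤ ∫⁻ x in (dgrid b).A k Q.corner, f x := lintegral_mono_set h1
    _ = (dgrid b).E k f Q.corner * (dgrid b).v k := ((dgrid b).E_mul k f _).symm
    _ ≤ (dgrid b).E k f Q.corner * (6 ^ d * Q.vol) := by gcongr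
    _ = _ := by ring

lemma sparse_le {d : ℕ} (S : Set (Cube d)) (hS : IsSparse S) (f g : (Fin d → ℝ) → ℝ≥0∞) :
    ∑' Q : S, avg 1 f (Q : Cube d) * avg 1 g (Q : Cube d) * (Q : Cube d).vol ≤
      2 * 36 ^ d * ∑ b : Fin d → Bool, ∫⁻ x, ⨆ k : ℤ, (dgrid b).E k f x * (dgrid b).E k g x := by
  obtain ⟨Es, h1, h2⟩ := hS
  set W : (Fin d → ℝ) → ℝ≥0∞ := fun x => ∑ b : Fin d → Bool, ⨆ k : ℤ, (dgrid b).E k f x * (dgrid b).E k g x with hW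
  have hone : ∀ Q ∈ S, avg 1 f Q * avg 1 g Q * Q.vol ≤ 2 * 36 ^ d * ∫⁻ x in Es Q, W x := by
    intro Q hQ
    obtain ⟨hm, hsub, hv⟩ := h1 Q hQ
    obtain ⟨b, k, c1, c2⟩ := cover Q
    have a1 := avg_le f Q b k c1 c2
    have a2 := avg_le g Q b k c1 c2
    calc avg 1 f Q * avg 1 g Q * Q.vol ≤ (6 ^ d * (dgrid b).E k f Q.corner) * (6 ^ d * (dgrid b).E k g Q.corner) * (2 * volume (Es Q)) := by
          gcongr
      _ = 2 * 36 ^ d * ∫⁻ x in Es Q, (dgrid b).E k f Q.corner * (dgrid b).E k g Q.corner := by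
          rw [setLIntegral_const, show (36:ℝ≥0∞) = 6 * 6 by norm_num, mul_pow]; ring
      _ ≤ _ := by
          gcongr 1
          apply setLIntegral_mono' hm
          intro x hx
          have hx' := c1 (hsub hx)
          rw [← (dgrid b).lev_E k f x _ hx', ← (dgrid b).lev_E k g x _ hx']
          refine le_trans (le_iSup (fun k : ℤ => (dgrid b).E k f x * (dgrid b).E k g x) k) ?_
          exact Finset.single_le_sum (f := fun b => ⨆ k : ℤ, (dgrid b).E k f x * (dgrid b).E k g x) (fun i _ => zero_le) (Finset.mem_univ b)
  have hintW : ∑ b : Fin d → Bool, ∫⁻ x, ⨆ k : ℤ, (dgrid b).E k f x * (dgrid b).E k g x = ∫⁻ x, W x := by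
    rw [hW, lintegral_finsetSum]
    intro b _
    exact Measurable.iSup fun k => ((dgrid b).meas_E _ _).mul ((dgrid b).meas_E _ _)
  rw [hintW, ENNReal.tsum_eq_iSup_sum]
  apply iSup_le
  intro s
  calc ∑ Q ∈ s, avg 1 f (Q : Cube d) * avg 1 g (Q : Cube d) * (Q : Cube d).vol 
      ≤ ∑ Q ∈ s, 2 * 36 ^ d * ∫⁻ x in Es Q, W x := Finset.sum_le_sum fun Q _ => hone Q Q.2
    _ = 2 * 36 ^ d * ∑ Q ∈ s, ∫⁻ x in Es Q, W x := by rw [Finset.mul_sum]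
    _ = 2 * 36 ^ d * ∫⁻ x in ⋃ Q ∈ s, Es Q, W x := by
        rw [lintegral_biUnion_finset]
        · intro Q _ Q' _ hne
          exact h2 Q.2 Q'.2 (fun h => hne (Subtype.ext h))
        · exact fun Q _ => (h1 Q Q.2).1
    _ ≤ _ := by
        gcongr
        exact Measure.restrict_le_self

lemma dual {X Ω : Type} [MeasurableSpace X] [MeasurableSpace Ω] (ν : Measure X) (μ : Measure Ω) [SigmaFinite μ]
    {t q : ℝ} (hpq : t.HolderConjugate q) (H : X → Ω → ℝ≥0∞) (hH : Measurable (Function.uncurry H))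
    (hHf : ∀ x ω, H x ω ≠ ∞) (g : X → ℝ≥0∞) (hg : Measurable g) (M : ℝ≥0∞) (hM : M ≠ ∞) (hgM : ∀ x, g x ≤ M) (K : ℝ≥0∞)
    (hK : ∀ G : X → Ω → ℝ≥0∞, Measurable (Function.uncurry G) → (∃ B : ℝ≥0∞, B ≠ ∞ ∧ ∀ x ω, G x ω ≤ B) →
      (∀ x ω, g x = 0 → G x ω = 0) → (∀ x, (∫⁻ ω, G x ω ^ q ∂μ) ^ (1/q) ≤ g x) → ∫⁻ x, ∫⁻ ω, H x ω * G x ω ∂μ ∂ν ≤ K) :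
    ∫⁻ x, (∫⁻ ω, H x ω ^ t ∂μ) ^ (1/t) * g x ∂ν ≤ K := by
  have ht := hpq.pos
  have hq := hpq.symm.pos
  have ht1 : 0 < t - 1 := by linarith [hpq.lt]
  have htq : (t-1) * q = t := hpq.sub_one_mul_conj
  set Hn : ℕ → X → Ω → ℝ≥0∞ := fun n x ω => (spanningSets μ n).indicator (fun ω => min (H x ω) n) ω with hHn
  have hHnm : ∀ n, Measurable (Function.uncurry (Hn n)) := by
    intro n
    have : Function.uncurry (Hn n) = (Prod.snd ⁻¹' spanningSets μ n).indicator (fun p => min (Function.uncurry H p) n) := by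
      ext ⟨x, ω⟩
      rfl
    rw [this]
    exact (hH.min measurable_const).indicator (measurable_snd (measurableSet_spanningSets μ n))
  have hHnω : ∀ n x, Measurable (Hn n x) := fun n x => (hHnm n).comp measurable_prodMk_left
  have hHnle : ∀ n x ω, Hn n x ω ≤ n := by
    intro n x ω
    simp only [hHn, Set.indicator]
    split_ifs
    · exact min_le_right _ _
    · exact zero_le
  have hHnH : ∀ n x ω, Hn n x ω ≤ H x ω := by
    intro n x ω
    simp only [hHn, Set.indicator]
    split_ifs
    · exact min_le_left _ _
    · exact zero_le
  have hHmono : ∀ x ω, Monotone (fun n => Hn n x ω) := by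
    intro x ω m n hmn
    simp only [hHn, Set.indicator]
    split_ifs with h1 h2
    · exact min_le_min le_rfl (by exact_mod_cast hmn)
    · exact absurd (monotone_spanningSets μ hmn h1) h2
    · exact zero_le
    · exact le_rfl
  have hHsup : ∀ x ω, ⨆ n, Hn n x ω = H x ω := by
    intro x ω
    apply le_antisymm (iSup_le fun n => hHnH n x ω)
    have hω : ω ∈ ⋃ n, spanningSets μ n := by rw [iUnion_spanningSets]; trivial
    obtain ⟨n1, hn1⟩ := Set.mem_iUnion.1 hω
    obtain ⟨n2, hn2⟩ := ENNReal.exists_nat_gt (hHf x ω)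
    refine le_trans ?_ (le_iSup _ (max n1 n2))
    simp only [hHn]
    rw [Set.indicator_of_mem (monotone_spanningSets μ (le_max_left n1 n2) hn1)]
    refine le_min le_rfl (hn2.le.trans ?_)
    exact_mod_cast le_max_right n1 n2
  set J : ℕ → X → ℝ≥0∞ := fun n x => ∫⁻ ω, Hn n x ω ^ t ∂μ with hJ
  set Nn : ℕ → X → ℝ≥0∞ := fun n x => (J n x) ^ (1/t) with hNn
  have hJm : ∀ n, Measurable (J n) := fun n => ((hHnm n).pow_const t).lintegral_prod_right'
  have hNm : ∀ n, Measurable (Nn n) := fun n => (hJm n).pow_const _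
  have hJf : ∀ n x, J n x ≠ ∞ := by
    intro n x
    have : J n x ≤ ∫⁻ ω in spanningSets μ n, (n:ℝ≥0∞)^t ∂μ := by
      rw [← lintegral_indicator (measurableSet_spanningSets μ n)]
      apply lintegral_mono
      intro ω
      simp only [hHn, Set.indicator]
      split_ifs
      · gcongr; exact min_le_right _ _
      · simp [ht]
    refine ne_top_of_le_ne_top ?_ this
    rw [setLIntegral_const]
    exact ENNReal.mul_ne_top (ENNReal.rpow_ne_top_of_nonneg ht.le (ENNReal.natCast_ne_top n)) (measure_spanningSets_lt_top μ n).ne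
  have hNf : ∀ n x, Nn n x ≠ ∞ := fun n x => ENNReal.rpow_ne_top_of_nonneg (by positivity) (hJf n x)
  have hNJ : ∀ n x, Nn n x ^ t = J n x := by
    intro n x
    simp only [hNn]
    rw [← ENNReal.rpow_mul, one_div_mul_cancel ht.ne', ENNReal.rpow_one]
  have hJmono : ∀ x, Monotone (fun n => J n x) := by
    intro x m n hmn
    apply lintegral_mono
    intro ω
    exact ENNReal.rpow_le_rpow (hHmono x ω hmn) ht.le
  have hNmono : ∀ x, Monotone (fun n => Nn n x) := fun x m n hmn =>
    ENNReal.rpow_le_rpow (hJmono x hmn) (by positivity)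
  have hNsup : ∀ x, (∫⁻ ω, H x ω ^ t ∂μ) ^ (1/t) = ⨆ n, Nn n x := by
    intro x
    have e : ∫⁻ ω, H x ω ^ t ∂μ = ⨆ n, J n x := by
      simp only [hJ]
      rw [← lintegral_iSup (fun n => (hHnω n x).pow_const t)]
      · congr 1
        ext ω
        rw [← hHsup x ω]
        exact (ENNReal.orderIsoRpow t ht).map_iSup _
      · intro m n hmn ω
        exact ENNReal.rpow_le_rpow (hHmono x ω hmn) ht.le
    rw [e]
    exact (ENNReal.orderIsoRpow (1/t) (by positivity)).map_iSup _
  set R : ℕ → X → ℝ≥0∞ := fun n x => {x | ((n:ℝ≥0∞))⁻¹ < Nn n x}.indicator (Nn n) x with hR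
  have hset : ∀ n : ℕ, MeasurableSet {x | ((n:ℝ≥0∞))⁻¹ < Nn n x} := fun n => measurableSet_lt measurable_const (hNm n)
  have hRm : ∀ n, Measurable (R n) := fun n => (hNm n).indicator (hset n)
  have hRmono : ∀ x, Monotone (fun n => R n x) := by
    intro x m n hmn
    simp only [hR, Set.indicator, Set.mem_ofPred_eq]
    split_ifs with h1 h2
    · exact hNmono x hmn
    · exfalso
      apply h2
      refine lt_of_le_of_lt ?_ (h1.trans_le (hNmono x hmn))
      exact ENNReal.inv_le_inv.2 (by exact_mod_cast hmn)
    · exact zero_le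
    · exact le_rfl
  have hRsup : ∀ x, ⨆ n, Nn n x ≤ ⨆ n, R n x := by
    intro x
    apply iSup_le
    intro m
    rcases eq_or_ne (Nn m x) 0 with h0 | h0
    · rw [h0]; exact zero_le
    obtain ⟨n, hn⟩ := ENNReal.exists_inv_nat_lt h0
    have h1 : ((max n m : ℕ) : ℝ≥0∞)⁻¹ < Nn (max n m) x := by
      refine lt_of_le_of_lt ?_ (hn.trans_le (hNmono x (le_max_right n m)))
      exact ENNReal.inv_le_inv.2 (by exact_mod_cast le_max_left n m)
    refine le_trans (hNmono x (le_max_right n m)) (le_trans (le_of_eq ?_) (le_iSup _ (max n m)))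
    simp only [hR]
    rw [Set.indicator_of_mem (show x ∈ {x | ((max n m : ℕ) : ℝ≥0∞)⁻¹ < Nn (max n m) x} from h1)]
  calc ∫⁻ x, (∫⁻ ω, H x ω ^ t ∂μ) ^ (1/t) * g x ∂ν ≤ ∫⁻ x, ⨆ n, R n x * g x ∂ν := by
        apply lintegral_mono
        intro x
        simp only
        rw [hNsup, ← ENNReal.iSup_mul]
        exact mul_le_mul' (hRsup x) le_rfl
    _ = ⨆ n, ∫⁻ x, R n x * g x ∂ν := by
        have hmm : ∀ n, Measurable (fun x => R n x * g x) := fun n => (hRm n).mul hg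
        rw [lintegral_iSup hmm]
        intro m n hmn x
        exact mul_le_mul' (hRmono x hmn) le_rfl
    _ ≤ K := by
      apply iSup_le
      intro n
      set G : X → Ω → ℝ≥0∞ := fun x ω => {x | ((n:ℝ≥0∞))⁻¹ < Nn n x}.indicator 
        (fun x => g x * ((Nn n x)^(t-1))⁻¹ * Hn n x ω ^ (t-1)) x with hG
      have hN0 : ∀ x, ((n:ℝ≥0∞))⁻¹ < Nn n x → Nn n x ≠ 0 := fun x h => (lt_of_le_of_lt zero_le h).ne'
      have hNp0 : ∀ x, ((n:ℝ≥0∞))⁻¹ < Nn n x → Nn n x ^ (t-1) ≠ 0 := fun x h =>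
        (ENNReal.rpow_pos (pos_iff_ne_zero.2 (hN0 x h)) (hNf n x)).ne'
      have hNpt : ∀ x, Nn n x ^ (t-1) ≠ ∞ := fun x => ENNReal.rpow_ne_top_of_nonneg ht1.le (hNf n x)
      refine le_trans ?_ (hK G ?_ ?_ ?_ ?_)
      · apply lintegral_mono
        intro x
        by_cases hx : ((n:ℝ≥0∞))⁻¹ < Nn n x
        · have e1 : R n x = Nn n x := Set.indicator_of_mem (show x ∈ {x | ((n:ℝ≥0∞))⁻¹ < Nn n x} from hx) _
          have e2 : ∀ ω, G x ω = g x * ((Nn n x)^(t-1))⁻¹ * Hn n x ω ^ (t-1) := fun ω =>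
            Set.indicator_of_mem (show x ∈ {x | ((n:ℝ≥0∞))⁻¹ < Nn n x} from hx) _
          have e3 : Nn n x * Nn n x ^ (t-1) = J n x := by
            rw [← hNJ]
            nth_rewrite 1 [← ENNReal.rpow_one (Nn n x)]
            rw [← ENNReal.rpow_add _ _ (hN0 x hx) (hNf n x)]
            congr 1; ring
          have e4 : Nn n x = J n x * ((Nn n x)^(t-1))⁻¹ := by
            rw [← e3, mul_assoc, ENNReal.mul_inv_cancel (hNp0 x hx) (hNpt x), mul_one]
          show R n x * g x ≤ ∫⁻ ω, H x ω * G x ω ∂μ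
          calc R n x * g x = g x * ((Nn n x)^(t-1))⁻¹ * J n x := by rw [e1]; nth_rewrite 1 [e4]; ring
            _ = ∫⁻ ω, g x * ((Nn n x)^(t-1))⁻¹ * Hn n x ω ^ t ∂μ := by
              have : Measurable (fun ω => Hn n x ω ^ t) := (hHnω n x).pow_const t
              rw [lintegral_const_mul _ this]
            _ ≤ _ := by
              apply lintegral_mono
              intro ω
              simp only
              rw [e2]
              have : Hn n x ω ^ t ≤ H x ω * Hn n x ω ^ (t-1) := by
                calc Hn n x ω ^ t = Hn n x ω ^ (1 + (t-1)) := by congr 1; ring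
                  _ = Hn n x ω ^ (1:ℝ) * Hn n x ω ^ (t-1) := ENNReal.rpow_add_of_nonneg _ _ (by norm_num) ht1.le
                  _ ≤ _ := by rw [ENNReal.rpow_one]; gcongr; exact hHnH n x ω
              calc g x * ((Nn n x)^(t-1))⁻¹ * Hn n x ω ^ t ≤ g x * ((Nn n x)^(t-1))⁻¹ * (H x ω * Hn n x ω ^ (t-1)) := by gcongr
                _ = _ := by ring
        · have e1 : R n x = 0 := Set.indicator_of_notMem (show x ∉ {x | ((n:ℝ≥0∞))⁻¹ < Nn n x} from hx) _
          simp only [e1, zero_mul]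
          exact zero_le
      · have : Function.uncurry G = (Prod.fst ⁻¹' {x | ((n:ℝ≥0∞))⁻¹ < Nn n x}).indicator 
          (fun p : X × Ω => g p.1 * ((Nn n p.1)^(t-1))⁻¹ * (Function.uncurry (Hn n) p) ^ (t-1)) := by
          ext ⟨x, ω⟩
          rfl
        rw [this]
        refine Measurable.indicator ?_ (measurable_fst (hset n))
        refine Measurable.mul (Measurable.mul (hg.comp measurable_fst) ?_) ((hHnm n).pow_const _)
        exact (((hNm n).pow_const _).comp measurable_fst).inv
      · refine ⟨M * (n:ℝ≥0∞) ^ (t-1) * (n:ℝ≥0∞) ^ (t-1), ?_, ?_⟩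
        · have : (n:ℝ≥0∞) ^ (t-1) ≠ ∞ := ENNReal.rpow_ne_top_of_nonneg ht1.le (ENNReal.natCast_ne_top n)
          exact ENNReal.mul_ne_top (ENNReal.mul_ne_top hM this) this
        · intro x ω
          simp only [hG, Set.indicator, Set.mem_ofPred_eq]
          split_ifs with hx
          · gcongr
            · exact hgM x
            · rw [← ENNReal.inv_rpow]
              gcongr
              exact ENNReal.inv_le_iff_inv_le.1 hx.le
            · exact hHnle n x ω
          · exact zero_le
      · intro x ω h
        simp [hG, Set.indicator, h]
      · intro x
        by_cases hx : ((n:ℝ≥0∞))⁻¹ < Nn n x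
        · have e2 : ∀ ω, G x ω = g x * ((Nn n x)^(t-1))⁻¹ * Hn n x ω ^ (t-1) := fun ω =>
            Set.indicator_of_mem (show x ∈ {x | ((n:ℝ≥0∞))⁻¹ < Nn n x} from hx) _
          have e3 : ∫⁻ ω, G x ω ^ q ∂μ = g x ^ q := by
            have hm' : Measurable (fun ω => Hn n x ω ^ t) := (hHnω n x).pow_const t
            have : ∀ ω, G x ω ^ q = g x ^ q * (J n x)⁻¹ * Hn n x ω ^ t := by
              intro ω
              rw [e2, ENNReal.mul_rpow_of_nonneg _ _ hq.le, ENNReal.mul_rpow_of_nonneg _ _ hq.le,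
                ← ENNReal.rpow_mul (Hn n x ω), htq, ENNReal.inv_rpow, ← ENNReal.rpow_mul (Nn n x), htq, hNJ]
            simp only [this]
            rw [lintegral_const_mul _ hm', mul_assoc, ENNReal.inv_mul_cancel _ (hJf n x), mul_one]
            rw [← hNJ]
            exact (ENNReal.rpow_pos (pos_iff_ne_zero.2 (hN0 x hx)) (hNf n x)).ne'
          rw [e3, ← ENNReal.rpow_mul, mul_one_div_cancel hq.ne', ENNReal.rpow_one]
        · have e2 : ∀ ω, G x ω = 0 := fun ω =>
            Set.indicator_of_notMem (show x ∉ {x | ((n:ℝ≥0∞))⁻¹ < Nn n x} from hx) _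
          simp [e2, hq]

lemma gcube_inj {d : ℕ} (hd : 1 ≤ d) (b : Fin d → Bool) :
    Function.Injective (fun p : ℤ × (Fin d → ℤ) => gcube b p.1 p.2) := by
  rintro ⟨k, m⟩ ⟨k', m'⟩ h
  simp only at h
  have hs := congrArg Cube.side h
  simp only [gcube] at hs
  have hk : -k = -k' := zpow_right_injective₀ (by norm_num) (by norm_num) hs
  have hk' : k = k' := by omega
  subst hk'
  have hc := congrArg Cube.corner h
  have : m = m' := by
    funext i
    have := congrFun hc i
    simp only [gcube] at this
    have h2 : (2:ℝ)^(-k) ≠ 0 := by positivity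
    have h3 := mul_left_cancel₀ h2 this
    have h4 : (m i : ℝ) = m' i := by linarith
    exact_mod_cast h4
  rw [this]

lemma scalar_cube {d : ℕ} (hd : 1 ≤ d) (b : Fin d → Bool) (f g : (Fin d → ℝ) → ℝ≥0∞) (hf : Measurable f) (hg : Measurable g)
    (hfi : ∫⁻ x, f x ≠ ∞) (hgi : ∫⁻ x, g x ≠ ∞) :
    ∃ S : Set (Cube d), IsSparse S ∧ ∫⁻ x, (⨆ k : ℤ, (dgrid b).E k f x * (dgrid b).E k g x) ≤
      64 * (2 ^ d) ^ 2 * ∑' Q : S, avg 1 f (Q : Cube d) * avg 1 g (Q : Cube d) * (Q : Cube d).vol := by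
  obtain ⟨S, Es, h1, h2, h3⟩ := (dgrid b).scalar f g hf hg hfi hgi (dgrid_v hd b) (one_le_pow₀ (by norm_num))
  have hinj := gcube_inj hd b
  set φ := fun p : ℤ × (Fin d → ℤ) => gcube b p.1 p.2 with hφ
  have hset : ∀ p : ℤ × (Fin d → ℤ), (φ p).set = (dgrid b).idx p.1 ⁻¹' {p.2} := fun p => gcube_set b p.1 p.2
  have hvol : ∀ p : ℤ × (Fin d → ℤ), (φ p).vol = (dgrid b).v p.1 := fun p => cube_vol _
  have hinv : ∀ p, Function.invFun φ (φ p) = p := Function.leftInverse_invFun hinj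
  refine ⟨φ '' S, ⟨fun Q => Es (Function.invFun φ Q), ?_, ?_⟩, ?_⟩
  · rintro _ ⟨p, hp, rfl⟩
    obtain ⟨-, q1, q2, q3⟩ := h1 p hp
    simp only [hinv]
    refine ⟨q1, ?_, ?_⟩
    · rw [hset]; exact q2
    · rw [hvol]; exact q3
  · rintro _ ⟨p, hp, rfl⟩ _ ⟨p', hp', rfl⟩ hne
    simp only [Function.onFun, hinv]
    exact h2 hp hp' (fun h => hne (by rw [h]))
  · refine h3.trans (le_of_eq ?_)
    rw [tsum_image (fun Q : Cube d => avg 1 f Q * avg 1 g Q * Q.vol) hinj.injOn]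
    have hE : ∀ (f : (Fin d → ℝ) → ℝ≥0∞) p, avg 1 f (φ p) = (dgrid b).EI f p := by
      intro f p
      rw [avg_one, hset, hvol]; rfl
    simp only [hE, hvol]
    rfl

lemma combined {d : ℕ} (hd : 1 ≤ d) {t q : ℝ} (hpq : t.HolderConjugate q) :
    ∃ K : ℝ≥0∞, K ≠ ∞ ∧ ∀ {Ω : Type} [MeasurableSpace Ω] (μ : Measure Ω) [SigmaFinite μ]
      (F : (Fin d → ℝ) → Ω → ℝ≥0∞) (_ : Measurable (Function.uncurry F)) (B : ℝ≥0∞) (_ : B ≠ ∞)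
      (_ : ∀ x ω, F x ω ≤ B) (Fn : (Fin d → ℝ) → ℝ≥0∞) (_ : Measurable Fn)
      (_ : ∀ x, (∫⁻ ω, F x ω ^ t ∂μ) ^ (1/t) ≤ Fn x) (_ : ∫⁻ x, Fn x ≠ ∞)
      (Gn : (Fin d → ℝ) → ℝ≥0∞) (_ : Measurable Gn) (_ : ∫⁻ x, Gn x ≠ ∞),
      ∃ S : Set (Cube d), IsSparse S ∧ 
        ∀ (G : (Fin d → ℝ) → Ω → ℝ≥0∞) (_ : Measurable (Function.uncurry G)) (B' : ℝ≥0∞) (_ : B' ≠ ∞)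
          (_ : ∀ x ω, G x ω ≤ B') (_ : ∀ x, (∫⁻ ω, G x ω ^ q ∂μ) ^ (1/q) ≤ Gn x),
        ∑ b : Fin d → Bool, ∫⁻ x, ∫⁻ ω, (⨆ k : ℤ, (dgrid b).E k (fun y => F y ω) x * (dgrid b).E k (fun y => G y ω) x) ∂μ
        ≤ K * ∑' Q : S, avg 1 Fn (Q : Cube d) * avg 1 Gn (Q : Cube d) * (Q : Cube d).vol := by
  obtain ⟨C, hC, hmain⟩ := Grid.main_sup (I := Fin d → ℤ) hpq
  refine ⟨2 ^ d * (C * (8 * (2 ^ d + 1)) ^ 2 * 2 * (64 * (2 ^ d) ^ 2)), by finiteness, ?_⟩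
  intro Ω _ μ _ F hF B hB hFB Fn hFnm hFn hFi Gn hGnm hGi
  choose Sb hSb1 hSb2 using fun b => scalar_cube hd b Fn Gn hFnm hGnm hFi hGi
  obtain ⟨b0, -, hb0⟩ := Finset.exists_max_image (Finset.univ : Finset (Fin d → Bool))
    (fun b => ∑' Q : Sb b, avg 1 Fn (Q : Cube d) * avg 1 Gn (Q : Cube d) * (Q : Cube d).vol) Finset.univ_nonempty
  refine ⟨Sb b0, hSb1 b0, ?_⟩
  intro G hG B' hB' hGB hGn
  calc _ ≤ ∑ b : Fin d → Bool, (C * (8 * (2 ^ d + 1)) ^ 2 * 2 * (64 * (2 ^ d) ^ 2)) * 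
          ∑' Q : Sb b0, avg 1 Fn (Q : Cube d) * avg 1 Gn (Q : Cube d) * (Q : Cube d).vol := by
        apply Finset.sum_le_sum
        intro b _
        have h1 := hmain (dgrid b) μ F hF B hB hFB Fn hFnm hFn G hG B' hB' hGB Gn hGnm hGn
          (fun k x => ENNReal.div_ne_top (ne_top_of_le_ne_top hFi (setLIntegral_le_lintegral _ _)) ((dgrid b).v_ne_zero k))
          (fun k x => ENNReal.div_ne_top (ne_top_of_le_ne_top hGi (setLIntegral_le_lintegral _ _)) ((dgrid b).v_ne_zero k))
        refine h1.trans ?_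
        rw [mul_assoc (C * (8 * (2 ^ d + 1)) ^ 2 * 2)]
        exact mul_le_mul' le_rfl ((hSb2 b).trans (mul_le_mul' le_rfl (hb0 b (Finset.mem_univ b))))
    _ = _ := by
        rw [Finset.sum_const, Finset.card_univ, nsmul_eq_mul]
        simp
        ring

lemma final_K {d : ℕ} {t q : ℝ} (hpq : t.HolderConjugate q)
    {Ω : Type} [MeasurableSpace Ω] (μ : Measure Ω) [SigmaFinite μ]
    (T : ((Fin d → ℝ) → ℂ) → ((Fin d → ℝ) → ℂ)) (C_T : ℝ≥0∞)
    (hsp : ∀ f g, MemLinftyC f → MemLinftyC g →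
          ∃ S : Set (Cube d), IsSparse S ∧
            ∫⁻ x, nn (T f) x * nn g x ≤
              C_T * ∑' Q : S, avg 1 (nn f) (Q : Cube d) * avg 1 (nn g) (Q : Cube d) *
                (Q : Cube d).vol)
    (f : (Fin d → ℝ) → Ω → ℂ) (hf : ∀ ω, MemLinftyC (fun y => f y ω)) (hfm : Measurable (Function.uncurry f))
    (hTm : Measurable (Function.uncurry fun x ω => T (fun y => f y ω) x))
    (g : (Fin d → ℝ) → ℂ) (hg : MemLinftyC g) (G : (Fin d → ℝ) → Ω → ℝ≥0∞) (hG : Measurable (Function.uncurry G))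
    (B : ℝ≥0∞) (hB : B ≠ ∞) (hGB : ∀ x ω, G x ω ≤ B) (hG0 : ∀ x ω, nn g x = 0 → G x ω = 0) :
    ∫⁻ x, ∫⁻ ω, nn (T (fun y => f y ω)) x * G x ω ∂μ ≤ C_T * (2 * 36 ^ d) *
      ∑ b : Fin d → Bool, ∫⁻ x, ∫⁻ ω, (⨆ k : ℤ, (dgrid b).E k (fun y => nn (fun z => f z ω) y) x * (dgrid b).E k (fun y => G y ω) x) ∂μ := by
  have hGf : ∀ x ω, G x ω ≠ ∞ := fun x ω => ne_top_of_le_ne_top hB (hGB x ω)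
  have hHm : Measurable (Function.uncurry fun x ω => nn (T (fun y => f y ω)) x * G x ω) :=
    (hTm.nnnorm.coe_nnreal_ennreal).mul hG
  have hFm : Measurable (Function.uncurry fun x ω => nn (fun z => f z ω) x) := hfm.nnnorm.coe_nnreal_ennreal
  have hsm : ∀ b : Fin d → Bool, Measurable (Function.uncurry fun x ω => 
      ⨆ k : ℤ, (dgrid b).E k (fun y => nn (fun z => f z ω) y) x * (dgrid b).E k (fun y => G y ω) x) := by
    intro b
    have : ∀ k : ℤ, Measurable (fun p : (Fin d → ℝ) × Ω => (dgrid b).E k (fun y => nn (fun z => f z p.2) y) p.1 * (dgrid b).E k (fun y => G y p.2) p.1) :=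
      fun k => ((dgrid b).meas_Ej hFm k).mul ((dgrid b).meas_Ej hG k)
    exact Measurable.iSup this
  have hω : ∀ ω, ∫⁻ x, nn (T (fun y => f y ω)) x * G x ω ≤ C_T * (2 * 36 ^ d) *
      ∑ b : Fin d → Bool, ∫⁻ x, (⨆ k : ℤ, (dgrid b).E k (fun y => nn (fun z => f z ω) y) x * (dgrid b).E k (fun y => G y ω) x) := by
    intro ω
    have hgg : nn (fun x => ((G x ω).toReal : ℂ)) = fun x => G x ω := by
      ext x
      show (‖(((G x ω).toReal : ℝ) : ℂ)‖₊ : ℝ≥0∞) = _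
      rw [Complex.nnnorm_real, ← enorm_eq_nnnorm, Real.enorm_of_nonneg ENNReal.toReal_nonneg,
        ENNReal.ofReal_toReal (hGf x ω)]
    have hgm : MemLinftyC (fun x => ((G x ω).toReal : ℂ)) := by
      refine ⟨?_, ⟨B.toReal, ?_⟩, ?_⟩
      · exact Complex.measurable_ofReal.comp (hG.comp (measurable_id.prodMk measurable_const)).ennreal_toReal
      · intro x
        rw [Complex.norm_real, Real.norm_of_nonneg ENNReal.toReal_nonneg]
        exact ENNReal.toReal_mono hB (hGB x ω)
      · refine hg.2.2.subset ?_
        intro x hx hx0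
        apply hx
        have : nn g x = 0 := by simp [nn, hx0]
        simp [hG0 x ω this]
    obtain ⟨S, hS, h⟩ := hsp _ _ (hf ω) hgm
    rw [hgg] at h
    refine h.trans ?_
    rw [mul_assoc]
    gcongr
    exact sparse_le S hS _ _
  calc _ = ∫⁻ ω, (∫⁻ x, nn (T (fun y => f y ω)) x * G x ω) ∂μ := lintegral_lintegral_swap hHm.aemeasurable
    _ ≤ ∫⁻ ω, (C_T * (2 * 36 ^ d) * ∑ b : Fin d → Bool, ∫⁻ x, (⨆ k : ℤ, (dgrid b).E k (fun y => nn (fun z => f z ω) y) x * (dgrid b).E k (fun y => G y ω) x)) ∂μ :=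
        lintegral_mono hω
    _ = C_T * (2 * 36 ^ d) * ∑ b : Fin d → Bool, ∫⁻ ω, (∫⁻ x, (⨆ k : ℤ, (dgrid b).E k (fun y => nn (fun z => f z ω) y) x * (dgrid b).E k (fun y => G y ω) x)) ∂μ := by
        have hm1 : ∀ b : Fin d → Bool, Measurable (fun ω => ∫⁻ x, (⨆ k : ℤ, (dgrid b).E k (fun y => nn (fun z => f z ω) y) x * (dgrid b).E k (fun y => G y ω) x)) :=
          fun b => (hsm b).lintegral_prod_left'
        rw [lintegral_const_mul _ (Finset.measurable_fun_sum _ fun b _ => hm1 b), lintegral_finsetSum _ (fun b _ => hm1 b)]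
    _ = _ := by
        congr 1
        refine Finset.sum_congr rfl fun b _ => ?_
        exact (lintegral_lintegral_swap (hsm b).aemeasurable).symm

lemma ind_mem {d : ℕ} {A : Set (Fin d → ℝ)} (hA : MeasurableSet A) (hb : Bornology.IsBounded A) (c : ℂ) :
    MemLinftyC (A.indicator (fun _ => c)) := by
  refine ⟨measurable_const.indicator hA, ⟨‖c‖, fun x => ?_⟩, hb.subset ?_⟩
  · exact norm_indicator_le_norm_self (fun _ => c) x
  · exact Set.support_indicator_subset

lemma linftyC_sum_mem {d : ℕ} {ι : Type} (s : Finset ι) (F : ι → (Fin d → ℝ) → ℂ) (hF : ∀ i, MemLinftyC (F i)) :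
    MemLinftyC (∑ i ∈ s, F i) := by
  classical
  induction s using Finset.induction_on with
  | empty => 
    refine ⟨by rw [Finset.sum_empty]; exact measurable_zero, ⟨0, by simp⟩, by simp⟩
  | insert a s ha ih =>
    rw [Finset.sum_insert ha]
    obtain ⟨h1, ⟨M, h2⟩, h3⟩ := hF a
    obtain ⟨k1, ⟨N, k2⟩, k3⟩ := ih
    refine ⟨h1.add k1, ⟨M + N, fun x => (norm_add_le _ _).trans (add_le_add (h2 x) (k2 x))⟩, (h3.union k3).subset ?_⟩
    exact Function.support_add _ _

lemma T_sum {d : ℕ} {ι : Type} (T : ((Fin d → ℝ) → ℂ) → ((Fin d → ℝ) → ℂ))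
    (hadd : ∀ f g, MemLinftyC f → MemLinftyC g → T (f + g) = T f + T g)
    (hsm : ∀ (c : ℂ) f, MemLinftyC f → T (c • f) = c • T f)
    (s : Finset ι) (F : ι → (Fin d → ℝ) → ℂ) (hF : ∀ i, MemLinftyC (F i)) :
    T (∑ i ∈ s, F i) = ∑ i ∈ s, T (F i) := by
  classical
  induction s using Finset.induction_on with
  | empty => 
    have h0 : MemLinftyC (0 : (Fin d → ℝ) → ℂ) := by simpa using linftyC_sum_mem (∅ : Finset ι) F hF
    have := hsm 0 0 h0
    simpa using this
  | insert a s ha ih =>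
    rw [Finset.sum_insert ha, Finset.sum_insert ha, hadd _ _ (hF a) (linftyC_sum_mem s F hF), ih]

lemma vs_facts {d : ℕ} {Ω : Type} [MeasurableSpace Ω] (T : ((Fin d → ℝ) → ℂ) → ((Fin d → ℝ) → ℂ))
    (hmeas : ∀ f, MemLinftyC f → Measurable (T f))
    (hadd : ∀ f g, MemLinftyC f → MemLinftyC g → T (f + g) = T f + T g)
    (hsm : ∀ (c : ℂ) f, MemLinftyC f → T (c • f) = c • T f)
    (f : (Fin d → ℝ) → Ω → ℂ) (hf : VecSimple f) :
    (∀ ω, MemLinftyC (fun y => f y ω)) ∧ Measurable (Function.uncurry f) ∧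
    Measurable (Function.uncurry fun x ω => T (fun y => f y ω) x) ∧
    (∃ B : ℝ≥0∞, B ≠ ∞ ∧ ∀ x ω, nn (fun z => f z ω) x ≤ B) ∧
    (∃ D : Set (Fin d → ℝ), Bornology.IsBounded D ∧ ∀ x ∉ D, ∀ ω, f x ω = 0) := by
  obtain ⟨N, A, ξ, hA, hAb, hξ, ⟨M, hM⟩, hfx⟩ := hf
  have hfω : ∀ ω, (fun y => f y ω) = ∑ i, (A i).indicator (fun _ => ξ i ω) := by
    intro ω; ext y; rw [hfx, Finset.sum_apply]
  have hind : ∀ i (c : ℂ), MemLinftyC ((A i).indicator (fun _ => c)) := fun i c => ind_mem (hA i) (hAb i) c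
  refine ⟨fun ω => ?_, ?_, ?_, ?_, ?_⟩
  · rw [hfω]; exact linftyC_sum_mem _ _ fun i => hind i _
  · have : Function.uncurry f = fun p : (Fin d → ℝ) × Ω => ∑ i, (A i ×ˢ (Set.univ : Set Ω)).indicator (fun p => ξ i p.2) p := by
      ext ⟨x, ω⟩
      simp only [Function.uncurry, hfx]
      refine Finset.sum_congr rfl fun i _ => ?_
      by_cases h : x ∈ A i <;> simp [Set.indicator, h]
    rw [this]
    refine Finset.measurable_fun_sum _ fun i _ => ?_
    exact ((hξ i).comp measurable_snd).indicator ((hA i).prod MeasurableSet.univ)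
  · have : (Function.uncurry fun x ω => T (fun y => f y ω) x) = 
      fun p : (Fin d → ℝ) × Ω => ∑ i, ξ i p.2 * T ((A i).indicator (fun _ => 1)) p.1 := by
      ext ⟨x, ω⟩
      simp only [Function.uncurry]
      rw [hfω, T_sum T hadd hsm _ _ (fun i => hind i _), Finset.sum_apply]
      refine Finset.sum_congr rfl fun i _ => ?_
      have : (A i).indicator (fun _ => ξ i ω) = ξ i ω • (A i).indicator (fun _ => (1:ℂ)) := by
        ext y; by_cases h : y ∈ A i <;> simp [h]
      rw [this, hsm _ _ (hind i 1)]
      simp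
    rw [this]
    refine Finset.measurable_fun_sum _ fun i _ => ?_
    exact ((hξ i).comp measurable_snd).mul ((hmeas _ (hind i 1)).comp measurable_fst)
  · refine ⟨ENNReal.ofReal (N * M), ENNReal.ofReal_ne_top, fun x ω => ?_⟩
    show (‖f x ω‖₊ : ℝ≥0∞) ≤ _
    rw [← enorm_eq_nnnorm, ← ofReal_norm]
    apply ENNReal.ofReal_le_ofReal
    rw [hfx]
    refine (norm_sum_le _ _).trans ?_
    calc _ ≤ ∑ i : Fin N, M := Finset.sum_le_sum fun i _ => (norm_indicator_le_norm_self (fun _ => ξ i ω) x).trans (hM i ω)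
      _ = _ := by simp
  · refine ⟨⋃ i, A i, (Bornology.isBounded_iUnion).2 hAb, fun x hx ω => ?_⟩
    rw [hfx]
    refine Finset.sum_eq_zero fun i _ => ?_
    exact Set.indicator_of_notMem (fun h => hx (Set.mem_iUnion.2 ⟨i, h⟩)) _

lemma big_cube {d : ℕ} {D : Set (Fin d → ℝ)} (hD : Bornology.IsBounded D) : ∃ Q : Cube d, D ⊆ Q.set := by
  obtain ⟨R, hR⟩ := hD.subset_closedBall 0
  refine ⟨⟨fun _ => -(|R| + 1), 2 * (|R| + 1) + 1, by positivity⟩, fun x hx i => ?_⟩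
  have := hR hx
  rw [mem_closedBall_zero_iff] at this
  have h2 := (norm_le_pi_norm x i).trans (this.trans (le_abs_self R))
  rw [Real.norm_eq_abs, abs_le] at h2
  simp only
  constructor <;> linarith [h2.1, h2.2]

lemma single_sparse {d : ℕ} (Q : Cube d) : IsSparse ({Q} : Set (Cube d)) := by
  refine ⟨fun Q => Q.set, ?_, Set.pairwiseDisjoint_singleton _ _⟩
  intro Q' _
  exact ⟨cube_meas Q', le_rfl, by rw [two_mul]; exact le_self_add⟩

lemma nn_int {d : ℕ} {g : (Fin d → ℝ) → ℂ} (hg : MemLinftyC g) : ∃ M : ℝ≥0∞, M ≠ ∞ ∧ (∀ x, nn g x ≤ M) ∧ ∫⁻ x, nn g x ≠ ∞ := by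
  obtain ⟨h1, ⟨M, h2⟩, h3⟩ := hg
  have hb : ∀ x, nn g x ≤ ENNReal.ofReal M := by
    intro x
    show (‖g x‖₊ : ℝ≥0∞) ≤ _
    rw [← enorm_eq_nnnorm, ← ofReal_norm]
    exact ENNReal.ofReal_le_ofReal (h2 x)
  refine ⟨ENNReal.ofReal M, by simp, hb, ?_⟩
  obtain ⟨Q, hQ⟩ := big_cube h3
  have : ∫⁻ x, nn g x = ∫⁻ x in Q.set, nn g x := by
    symm
    rw [← lintegral_indicator (cube_meas Q), Set.indicator_eq_self.2]
    intro x hx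
    apply hQ
    intro h
    exact hx (by simp [nn, h])
  rw [this]
  refine ne_top_of_le_ne_top ?_ (setLIntegral_mono measurable_const (fun x _ => hb x))
  rw [setLIntegral_const]
  exact ENNReal.mul_ne_top (by simp) (vol_ne_top Q)

lemma main_proof (d : ℕ) (hd : 1 ≤ d) (t : ℝ≥0∞) (ht1 : 1 < t) (ht2 : t ≠ ∞) :
    ∃ C : ℝ≥0∞, 0 < C ∧ C ≠ ∞ ∧
      ∀ (Ω : Type) [MeasurableSpace Ω] (μ : Measure Ω) [SigmaFinite μ],
      ∀ (T : ((Fin d → ℝ) → ℂ) → ((Fin d → ℝ) → ℂ)) (C_T : ℝ≥0∞),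
        -- T maps L^∞_c into measurable functions
        (∀ f, MemLinftyC f → Measurable (T f)) →
        -- T is linear
        (∀ f g, MemLinftyC f → MemLinftyC g → T (f + g) = T f + T g) →
        (∀ (c : ℂ) f, MemLinftyC f → T (c • f) = c • T f) →
        -- scalar-valued sparse domination
        (∀ f g, MemLinftyC f → MemLinftyC g →
          ∃ S : Set (Cube d), IsSparse S ∧
            ∫⁻ x, nn (T f) x * nn g x ≤
              C_T * ∑' Q : S, avg 1 (nn f) (Q : Cube d) * avg 1 (nn g) (Q : Cube d) *
                (Q : Cube d).vol) →
        -- vector-valued sparse domination of the tensor extension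
        ∀ (f : (Fin d → ℝ) → Ω → ℂ), VecSimple f →
        ∀ (g : (Fin d → ℝ) → ℂ), MemLinftyC g →
          ∃ S : Set (Cube d), IsSparse S ∧
            ∫⁻ x, eNorm t μ (fun ω => (‖T (fun y => f y ω) x‖₊ : ℝ≥0∞)) * nn g x ≤
              C * C_T * ∑' Q : S,
                avg 1 (fun x => eNorm t μ (nn (f x))) (Q : Cube d) *
                  avg 1 (nn g) (Q : Cube d) * (Q : Cube d).vol := by
  have ht : 1 < t.toReal := by
    rw [← ENNReal.toReal_one]
    exact (ENNReal.toReal_lt_toReal (by simp) ht2).2 ht1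
  have hpq := Real.HolderConjugate.conjExponent ht
  set q := t.toReal.conjExponent with hq
  obtain ⟨K, hK, hcomb⟩ := combined hd hpq
  refine ⟨2 * 36 ^ d * K + 1, by positivity, by finiteness, ?_⟩
  intro Ω _ μ _ T C_T hmeas hadd hsm hsp f hf g hg
  obtain ⟨hfω, hfm, hTm, ⟨B, hB, hfB⟩, ⟨D, hD, hfD⟩⟩ := vs_facts T hmeas hadd hsm f hf
  obtain ⟨M, hM, hgM, hgi⟩ := nn_int hg
  have hgm : Measurable (nn g) := hg.1.nnnorm.coe_nnreal_ennreal
  have hFm : Measurable (Function.uncurry fun x ω => nn (fun z => f z ω) x) := hfm.nnnorm.coe_nnreal_ennreal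
  have hHm : Measurable (Function.uncurry fun x ω => nn (T (fun y => f y ω)) x) := hTm.nnnorm.coe_nnreal_ennreal
  have heN : ∀ h : Ω → ℝ≥0∞, eNorm t μ h = (∫⁻ ω, h ω ^ t.toReal ∂μ) ^ (1 / t.toReal) := fun h => if_neg ht2
  set Fn : (Fin d → ℝ) → ℝ≥0∞ := fun x => eNorm t μ (nn (f x)) with hFn
  have hFne : ∀ x, Fn x = (∫⁻ ω, nn (fun z => f z ω) x ^ t.toReal ∂μ) ^ (1 / t.toReal) := fun x => heN _
  have hFnm : Measurable Fn := by
    have : Fn = fun x => (∫⁻ ω, nn (fun z => f z ω) x ^ t.toReal ∂μ) ^ (1 / t.toReal) := funext hFne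
    rw [this]
    exact (Measurable.lintegral_prod_right' (hFm.pow_const t.toReal)).pow_const _
  have hdual : ∀ K' : ℝ≥0∞, (∀ G : (Fin d → ℝ) → Ω → ℝ≥0∞, Measurable (Function.uncurry G) →
      (∃ B : ℝ≥0∞, B ≠ ∞ ∧ ∀ x ω, G x ω ≤ B) →
      (∀ x, (∫⁻ ω, G x ω ^ q ∂μ) ^ (1/q) ≤ nn g x) →
      C_T * (2 * 36 ^ d) *
      ∑ b : Fin d → Bool, ∫⁻ x, ∫⁻ ω, (⨆ k : ℤ, (dgrid b).E k (fun y => nn (fun z => f z ω) y) x * (dgrid b).E k (fun y => G y ω) x) ∂μ ≤ K') →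
      ∫⁻ x, eNorm t μ (fun ω => (‖T (fun y => f y ω) x‖₊ : ℝ≥0∞)) * nn g x ≤ K' := by
    intro K' h
    simp only [heN]
    refine dual volume μ hpq (fun x ω => nn (T (fun y => f y ω)) x) hHm (fun x ω => by simp [nn]) (nn g) hgm M hM hgM K' ?_
    intro G hG hGB hG0 hGn
    obtain ⟨B', hB', hGB'⟩ := hGB
    exact (final_K hpq μ T C_T hsp f hfω hfm hTm g hg G hG B' hB' hGB' hG0).trans (h G hG ⟨B', hB', hGB'⟩ hGn)
  by_cases hFi : ∫⁻ x, Fn x = ∞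
  · obtain ⟨Q, hQ⟩ := big_cube (hD.union hg.2.2)
    refine ⟨{Q}, single_sparse Q, ?_⟩
    by_cases hC0 : C_T = 0
    · apply hdual
      intro G _ _ _
      simp [hC0]
    by_cases hg0 : ∫⁻ x, nn g x = 0
    · rw [lintegral_eq_zero_iff hgm] at hg0
      have : ∫⁻ x, eNorm t μ (fun ω => (‖T (fun y => f y ω) x‖₊ : ℝ≥0∞)) * nn g x = 0 := by
        rw [← lintegral_zero]
        apply lintegral_congr_ae
        filter_upwards [hg0] with x hx
        simp [hx]
      rw [this]
      exact zero_le
    have hsupp : ∀ h : (Fin d → ℝ) → ℝ≥0∞, (∀ x ∉ Q.set, h x = 0) → ∫⁻ x in Q.set, h x = ∫⁻ x, h x := by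
      intro h hh
      rw [← lintegral_indicator (cube_meas Q), Set.indicator_eq_self.2]
      intro x hx
      by_contra hxQ
      exact hx (hh x hxQ)
    have e1 : ∫⁻ x in Q.set, Fn x = ∞ := by
      rw [hsupp, hFi]
      intro x hx
      have : ∀ ω, f x ω = 0 := hfD x (fun h => hx (hQ (Or.inl h)))
      rw [hFne]
      simp [nn, this, zero_lt_one.trans ht]
    have e2 : ∫⁻ x in Q.set, nn g x ≠ 0 := by
      rw [hsupp]
      · exact hg0
      intro x hx
      have : g x = 0 := by
        by_contra h
        exact hx (hQ (Or.inr h))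
      simp [nn, this]
    have e3 : avg 1 Fn Q = ∞ := by
      rw [avg_one, e1, ENNReal.top_div_of_ne_top (vol_ne_top Q)]
    have e4 : avg 1 (nn g) Q ≠ 0 := by
      rw [avg_one]
      exact ENNReal.div_ne_zero.2 ⟨e2, vol_ne_top Q⟩
    rw [tsum_singleton Q (fun Q : Cube d => avg 1 Fn Q * avg 1 (nn g) Q * Q.vol), e3, ENNReal.top_mul e4, ENNReal.top_mul (vol_ne_zero Q), ENNReal.mul_top]
    · exact le_top
    · exact mul_ne_zero (by positivity) hC0
  · obtain ⟨S, hS, h⟩ := hcomb μ (fun x ω => nn (fun z => f z ω) x) hFm B hB hfB Fn hFnm (fun x => (hFne x).ge) hFi (nn g) hgm hgi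
    refine ⟨S, hS, hdual _ ?_⟩
    rintro G hG ⟨B', hB', hGB'⟩ hGn
    refine (mul_le_mul' le_rfl (h G hG B' hB' hGB' hGn)).trans ?_
    rw [← mul_assoc]
    refine mul_le_mul' ?_ le_rfl
    calc C_T * (2 * 36 ^ d) * K = (2 * 36 ^ d * K) * C_T := by ring
      _ ≤ _ := mul_le_mul' le_self_add le_rfl

/-- scalar-valued sparse domination of a linear operator implies
`L^t(Ω)`-valued sparse domination of its tensor extension. -/
theorem statement14 (d : ℕ) (hd : 1 ≤ d) (t : ℝ≥0∞) (ht1 : 1 < t) (ht2 : t ≠ ∞) :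
    ∃ C : ℝ≥0∞, 0 < C ∧ C ≠ ∞ ∧
      ∀ (Ω : Type) [MeasurableSpace Ω] (μ : Measure Ω) [SigmaFinite μ],
      ∀ (T : ((Fin d → ℝ) → ℂ) → ((Fin d → ℝ) → ℂ)) (C_T : ℝ≥0∞),
        -- T maps L^∞_c into measurable functions
        (∀ f, MemLinftyC f → Measurable (T f)) →
        -- T is linear
        (∀ f g, MemLinftyC f → MemLinftyC g → T (f + g) = T f + T g) →
        (∀ (c : ℂ) f, MemLinftyC f → T (c • f) = c • T f) →
        -- scalar-valued sparse domination
        (∀ f g, MemLinftyC f → MemLinftyC g →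
          ∃ S : Set (Cube d), IsSparse S ∧
            ∫⁻ x, nn (T f) x * nn g x ≤
              C_T * ∑' Q : S, avg 1 (nn f) (Q : Cube d) * avg 1 (nn g) (Q : Cube d) *
                (Q : Cube d).vol) →
        -- vector-valued sparse domination of the tensor extension
        ∀ (f : (Fin d → ℝ) → Ω → ℂ), VecSimple f →
        ∀ (g : (Fin d → ℝ) → ℂ), MemLinftyC g →
          ∃ S : Set (Cube d), IsSparse S ∧
            ∫⁻ x, eNorm t μ (fun ω => (‖T (fun y => f y ω) x‖₊ : ℝ≥0∞)) * nn g x ≤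
              C * C_T * ∑' Q : S,
                avg 1 (fun x => eNorm t μ (nn (f x))) (Q : Cube d) *
                  avg 1 (nn g) (Q : Cube d) * (Q : Cube d).vol := by
  exact main_proof d hd t ht1 ht2

end
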